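/- arXiv:math/0408058 — 6 statements merged into one kernel-verified Lean document; each statement's English description precedes it below -/
import Mathlib

section
/- Let R be a commutative ring and I, J ideals of R such that Tor_i^R(R/I, R/J) = 0 for all i ≥ 1. Then the multiplication map I ⊗_R J → I·J, x ⊗ y ↦ x·y, is an isomorphism of R-modules; in particular I·J ≅ I ⊗_R J. -/
open CategoryTheory

theorem rTensor_lTensor_apply {R A B M N : Type*} [CommRing R] [AddCommGroup A] [Module R A]
    [AddCommGroup B] [Module R B] [AddCommGroup M] [Module R M] [AddCommGroup N] [Module R N]
    (a : A →ₗ[R] B) (f : M →ₗ[R] N) (x : TensorProduct R A M) :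
    a.rTensor N (f.lTensor A x) = f.lTensor B (a.rTensor M x) := by
  simp only [← LinearMap.comp_apply, LinearMap.rTensor_comp_lTensor,
    LinearMap.lTensor_comp_rTensor]

open Function in
/-- If `P₃ → P₂ → P₁ → Z → 0` is exact at `P₁` and `Z` with `P₁` flat, and it stays exact at `P₂`
after tensoring with `R ⧸ I`, then `I ⊗ Z → R ⊗ Z` is injective. -/
theorem rTensor_subtype_injective_of_exact {R P₃ P₂ P₁ Z : Type*} [CommRing R] (I : Ideal R)
    [AddCommGroup P₃] [Module R P₃] [AddCommGroup P₂] [Module R P₂]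
    [AddCommGroup P₁] [Module R P₁] [AddCommGroup Z] [Module R Z] [Module.Flat R P₁]
    {d₃ : P₃ →ₗ[R] P₂} {d₂ : P₂ →ₗ[R] P₁} {g : P₁ →ₗ[R] Z}
    (hd : d₂ ∘ₗ d₃ = 0) (hdg : Exact d₂ g) (hg : Surjective g)
    (hI : Exact (d₃.lTensor (R ⧸ I)) (d₂.lTensor (R ⧸ I))) :
    Injective (I.subtype.rTensor Z) := by
  rw [injective_iff_map_eq_zero]
  intro t ht
  obtain ⟨t, rfl⟩ := LinearMap.lTensor_surjective I hg t
  rw [rTensor_lTensor_apply] at ht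
  obtain ⟨q, hq⟩ := (lTensor_exact R hdg hg _).1 ht
  have hq0 : d₂.lTensor (R ⧸ I) (I.mkQ.rTensor P₂ q) = 0 := by
    rw [← rTensor_lTensor_apply, hq]
    exact (rTensor_exact P₁ (LinearMap.exact_subtype_mkQ I) I.mkQ_surjective).apply_apply_eq_zero t
  obtain ⟨r, hr⟩ := (hI _).1 hq0
  obtain ⟨r, rfl⟩ := LinearMap.rTensor_surjective P₃ I.mkQ_surjective r
  rw [← rTensor_lTensor_apply, ← sub_eq_zero, ← map_sub] at hr
  obtain ⟨k, hk⟩ := (rTensor_exact P₂ (LinearMap.exact_subtype_mkQ I) I.mkQ_surjective _).1 hr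
  have hdd : d₂.lTensor R (d₃.lTensor R r) = 0 := by
    rw [← LinearMap.lTensor_comp_apply, hd, LinearMap.lTensor_zero, LinearMap.zero_apply]
  have htk : t = d₂.lTensor I (-k) := by
    apply Module.Flat.rTensor_preserves_injective_linearMap I.subtype I.subtype_injective
    rw [rTensor_lTensor_apply, map_neg, hk, ← hq, neg_sub, map_sub, hdd, sub_zero]
  rw [htk]
  exact (lTensor_exact I hdg hg).apply_apply_eq_zero _

open Function in
/-- Injectivity of `I ⊗ K → R ⊗ K` does not depend on the choice of the first syzygy `K` of
`R ⧸ J`. -/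
theorem rTensor_subtype_injective_of_ker {R P : Type*} [CommRing R] (I J : Ideal R)
    [AddCommGroup P] [Module R P] [Module.Projective R P] {p : P →ₗ[R] R ⧸ J} (hp : Surjective p)
    (h : Injective (I.subtype.rTensor (LinearMap.ker p))) :
    Injective (I.subtype.rTensor J) := by
  obtain ⟨f, hf⟩ := Module.projective_lifting_property p J.mkQ hp
  obtain ⟨g, hg⟩ := Module.projective_lifting_property J.mkQ p J.mkQ_surjective
  have hf' (x : R) : p (f x) = J.mkQ x := LinearMap.congr_fun hf x
  have hg' (x : P) : J.mkQ (g x) = p x := LinearMap.congr_fun hg x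
  have hJ (x : R) : J.mkQ x = 0 ↔ x ∈ J := Submodule.Quotient.mk_eq_zero J
  let f₀ : J →ₗ[R] LinearMap.ker p := f.restrict fun x hx => by
    rw [LinearMap.mem_ker, hf']; exact (hJ x).2 hx
  let g₀ : LinearMap.ker p →ₗ[R] J := g.restrict fun x hx => by
    rw [← hJ, hg']; exact hx
  let s : R →ₗ[R] J := (LinearMap.id - g ∘ₗ f).codRestrict J fun x => by
    rw [← hJ]
    simp only [LinearMap.sub_apply, LinearMap.comp_apply, LinearMap.id_apply, map_sub]
    rw [hg', hf', sub_self]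
  have hs : g₀ ∘ₗ f₀ + s ∘ₗ J.subtype = LinearMap.id := by
    ext x
    simp [g₀, f₀, s]
  rw [injective_iff_map_eq_zero]
  intro t ht
  have h₁ : f₀.lTensor I t = 0 := by
    apply h
    rw [rTensor_lTensor_apply, ht, map_zero, map_zero]
  have h₂ : J.subtype.lTensor I t = 0 := by
    apply Module.Flat.rTensor_preserves_injective_linearMap (M := R) I.subtype I.subtype_injective
    rw [rTensor_lTensor_apply, ht, map_zero, map_zero]
  rw [← LinearMap.lTensor_id_apply I J t, ← hs, LinearMap.lTensor_add, LinearMap.add_apply,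
    LinearMap.lTensor_comp_apply, LinearMap.lTensor_comp_apply, h₁, h₂, map_zero, map_zero,
    add_zero]

/-- Vanishing of `Tor₂(R ⧸ I, R ⧸ J)` makes `I ⊗ J → R ⊗ J` injective. -/
theorem rTensor_subtype_injective_of_subsingleton_tor {R : Type} [CommRing R] (I J : Ideal R)
    (h : Subsingleton
      (((Tor (ModuleCat R) 2).obj (ModuleCat.of R (R ⧸ I))).obj (ModuleCat.of R (R ⧸ J)))) :
    Function.Injective (I.subtype.rTensor J) := by
  let P := ProjectiveResolution.of (ModuleCat.of R (R ⧸ J))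
  let F := (MonoidalCategory.tensoringLeft (ModuleCat R)).obj (ModuleCat.of R (R ⧸ I))
  let K := (F.mapHomologicalComplex _).obj P.complex
  have hK : K.ExactAt 2 := by
    rw [HomologicalComplex.exactAt_iff_isZero_homology]
    exact (@ModuleCat.isZero_of_subsingleton _ _ _ h).of_iso (P.isoLeftDerivedObj F 2).symm
  rw [K.exactAt_iff' 3 2 1 (by simp) (by simp),
    ShortComplex.ShortExact.moduleCat_exact_iff_function_exact] at hK
  have hproj (n : ℕ) : Module.Projective R (P.complex.X n) :=
    (IsProjective.iff_projective _).2 (P.projective n)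
  have := hproj 0
  have := hproj 1
  let p : P.complex.X 0 →ₗ[R] R ⧸ J := (P.π.f 0).hom
  have hp : Function.Surjective p :=
    (ModuleCat.epi_iff_surjective (P.π.f 0)).1 inferInstance
  have hd₁ : Function.Exact (P.complex.d 1 0).hom p :=
    (ShortComplex.ShortExact.moduleCat_exact_iff_function_exact _).1 P.exact₀
  have hd₂ : Function.Exact (P.complex.d 2 1).hom (P.complex.d 1 0).hom :=
    (ShortComplex.ShortExact.moduleCat_exact_iff_function_exact _).1 (P.exact_succ 0)
  let g : P.complex.X 1 →ₗ[R] LinearMap.ker p :=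
    (P.complex.d 1 0).hom.codRestrict _ hd₁.apply_apply_eq_zero
  refine rTensor_subtype_injective_of_ker I J hp <|
    rTensor_subtype_injective_of_exact I (d₃ := (P.complex.d 3 2).hom)
      (d₂ := (P.complex.d 2 1).hom) (g := g) ?_ ?_ ?_ hK
  · rw [← ModuleCat.hom_comp, P.complex.d_comp_d, ModuleCat.hom_zero]
  · intro x
    rw [← hd₂ x]
    exact Subtype.ext_iff
  · rintro ⟨z, hz⟩
    obtain ⟨x, rfl⟩ := (hd₁ z).1 hz
    exact ⟨x, rfl⟩

/-- Let `R` be a commutative ring and `I, J` ideals such that `Tor_i^R(R/I, R/J) = 0` for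
all `i ≥ 1`. Then the multiplication map `I ⊗[R] J → I·J`, `x ⊗ y ↦ x·y`, is an
isomorphism of `R`-modules; in particular `I·J ≅ I ⊗[R] J`. -/
theorem stmt_5 (R : Type) [CommRing R] (I J : Ideal R)
    (h : ∀ i : ℕ, 1 ≤ i →
      Subsingleton
        (((Tor (ModuleCat R) i).obj (ModuleCat.of R (R ⧸ I))).obj
          (ModuleCat.of R (R ⧸ J)))) :
    Function.Bijective (Submodule.mulMap' I J) := by
  refine ⟨?_, Submodule.mulMap'_surjective I J⟩
  have hinj := rTensor_subtype_injective_of_subsingleton_tor I J (h 2 one_le_two)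
  have hcomp : (I * J).subtype ∘ₗ Submodule.mulMap' I J =
      J.subtype ∘ₗ (TensorProduct.lid R J).toLinearMap ∘ₗ I.subtype.rTensor J := by
    ext x y
    simp
  refine Function.Injective.of_comp (f := (I * J).subtype) ?_
  rw [← LinearMap.coe_comp, hcomp]
  exact J.subtype_injective.comp ((TensorProduct.lid R J).injective.comp hinj)
end

section
/- Let R be a commutative Noetherian local ring and suppose x_1, …, x_r, y_1, …, y_s ∈ R is a regular sequence (the concatenated sequence is regular). Then Tor_i^R(R/(x_1,…,x_r), R/(y_1,…,y_s)) = 0 for all i ≥ 1. -/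
open CategoryTheory

section TorRegular

open MonoidalCategory RingTheory.Sequence TensorProduct

universe u

variable {R : Type u} [CommRing R]

/-- Tensoring a fixed chain complex `K` of modules with a variable module, on the left. -/
noncomputable def tensorChainComplex (K : ChainComplex (ModuleCat.{u} R) ℕ) :
    ModuleCat.{u} R ⥤ ChainComplex (ModuleCat.{u} R) ℕ where
  obj X := (((tensoringLeft (ModuleCat.{u} R)).obj X).mapHomologicalComplex _).obj K
  map f := (NatTrans.mapHomologicalComplex ((tensoringLeft (ModuleCat.{u} R)).map f) _).app K

instance (K : ChainComplex (ModuleCat.{u} R) ℕ) : (tensorChainComplex K).Additive where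
  map_add {X Y f g} := by
    ext n : 1
    exact (tensorRight (K.X n)).map_add

lemma tensorChainComplex_map_smul (K : ChainComplex (ModuleCat.{u} R) ℕ) (X : ModuleCat.{u} R)
    (r : R) : (tensorChainComplex K).map (r • 𝟙 X) = r • 𝟙 ((tensorChainComplex K).obj X) := by
  ext n : 1
  refine (MonoidalLinear.smul_whiskerRight r (𝟙 X) (K.X n)).trans ?_
  rw [id_whiskerRight]
  rfl

lemma shortExact_map_tensorChainComplex (K : ChainComplex (ModuleCat.{u} R) ℕ)
    [∀ n, Module.Flat R (K.X n)] {S : ShortComplex (ModuleCat.{u} R)} (hS : S.ShortExact) :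
    (S.map (tensorChainComplex K)).ShortExact := by
  refine HomologicalComplex.shortExact_of_degreewise_shortExact _ fun n => ?_
  have := hS.mono_f
  have := hS.epi_g
  exact hS.map (tensorRight (K.X n))

lemma tensorChainComplex_exactAt_of_flat {Y : ModuleCat.{u} R} (P : ProjectiveResolution Y)
    (X : ModuleCat.{u} R) [Module.Flat R X] (n : ℕ) :
    ((tensorChainComplex P.complex).obj X).ExactAt (n + 1) :=
  (P.complex_exactAt_succ n).map (tensorLeft X)

/-- The modules `Tor_i(X, Y)` are computed by a projective resolution of `Y`. -/
noncomputable def torIsoHomologyTensorChainComplex {Y : ModuleCat.{u} R}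
    (P : ProjectiveResolution Y) (X : ModuleCat.{u} R) (n : ℕ) :
    ((Tor (ModuleCat.{u} R) n).obj X).obj Y ≅ ((tensorChainComplex P.complex).obj X).homology n :=
  P.isoLeftDerivedObj ((tensoringLeft (ModuleCat.{u} R)).obj X) n

/-- The degree zero homology of `X ⊗ P` is `X ⊗ Y`, where `P` is a projective resolution
of `Y`. -/
noncomputable def homologyZeroTensorChainComplexIso {Y : ModuleCat.{u} R}
    (P : ProjectiveResolution Y) (X : ModuleCat.{u} R) :
    ((tensorChainComplex P.complex).obj X).homology 0 ≅ ModuleCat.of R (X ⊗[R] Y) :=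
  haveI : Limits.PreservesFiniteColimits ((tensoringLeft (ModuleCat.{u} R)).obj X) :=
    inferInstanceAs (Limits.PreservesFiniteColimits (tensorLeft X))
  (torIsoHomologyTensorChainComplex P X 0).symm ≪≫
    ((tensoringLeft (ModuleCat.{u} R)).obj X).leftDerivedZeroIsoSelf.app Y

lemma homologyMap_tensorChainComplex_map_smul (K : ChainComplex (ModuleCat.{u} R) ℕ)
    (X : ModuleCat.{u} R) (r : R) (n : ℕ) :
    HomologicalComplex.homologyMap ((tensorChainComplex K).map (r • 𝟙 X)) n =
      r • 𝟙 (((tensorChainComplex K).obj X).homology n) := by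
  rw [tensorChainComplex_map_smul]
  refine (ShortComplex.homologyMap_smul (a := r)
    (φ := 𝟙 (((tensorChainComplex K).obj X).sc n))).trans ?_
  rw [ShortComplex.homologyMap_id]
  rfl

lemma mono_homologyMap_zero_tensorChainComplex_map_smul {Y : ModuleCat.{u} R}
    (P : ProjectiveResolution Y) (X : ModuleCat.{u} R) (r : R)
    (h : IsSMulRegular (X ⊗[R] Y) r) :
    Mono (HomologicalComplex.homologyMap ((tensorChainComplex P.complex).map (r • 𝟙 X)) 0) := by
  rw [homologyMap_tensorChainComplex_map_smul, ModuleCat.mono_iff_injective]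
  exact ((homologyZeroTensorChainComplexIso P X).toLinearEquiv.isSMulRegular_congr r).mpr h

lemma tensorChainComplex_exactAt_quotSMulTop {Y : ModuleCat.{u} R} (P : ProjectiveResolution Y)
    (X : ModuleCat.{u} R) (r : R) (hX : IsSMulRegular X r) (hXY : IsSMulRegular (X ⊗[R] Y) r)
    (h : ∀ n, ((tensorChainComplex P.complex).obj X).ExactAt (n + 1)) (n : ℕ) :
    ((tensorChainComplex P.complex).obj (ModuleCat.of R (QuotSMulTop r X))).ExactAt (n + 1) := by
  have hflat (n : ℕ) : Module.Flat R (P.complex.X n) := by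
    have : Module.Projective R (P.complex.X n) :=
      (IsProjective.iff_projective _).mpr (P.projective n)
    infer_instance
  have hS := shortExact_map_tensorChainComplex P.complex hX.smulShortComplex_shortExact
  have hdown : (ComplexShape.down ℕ).Rel (n + 1) n := by simp
  rw [HomologicalComplex.exactAt_iff_isZero_homology]
  refine (hS.homology_exact₃ (n + 1) n hdown).isZero_of_both_zeros ?_ ?_
  · exact ((HomologicalComplex.exactAt_iff_isZero_homology _ _).mp (h n)).eq_of_src _ _
  · cases n with
    | succ n => exact ((HomologicalComplex.exactAt_iff_isZero_homology _ _).mp (h n)).eq_of_tgt _ _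
    | zero =>
      have : Mono (HomologicalComplex.homologyMap
          ((X.smulShortComplex r).map (tensorChainComplex P.complex)).f 0) :=
        mono_homologyMap_zero_tensorChainComplex_map_smul P X r hXY
      exact (cancel_mono _).mp ((hS.δ_comp 1 0 hdown).trans Limits.zero_comp.symm)

lemma tensorChainComplex_exactAt_quot_ofList {Y : ModuleCat.{u} R} (P : ProjectiveResolution Y)
    (rs : List R) (X : ModuleCat.{u} R) (hX : IsWeaklyRegular X rs)
    (hXY : IsWeaklyRegular (X ⊗[R] Y) rs)
    (h : ∀ n, ((tensorChainComplex P.complex).obj X).ExactAt (n + 1)) (n : ℕ) :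
    ((tensorChainComplex P.complex).obj
      (ModuleCat.of R (X ⧸ (Ideal.ofList rs • ⊤ : Submodule R X)))).ExactAt (n + 1) := by
  induction rs generalizing X with
  | nil =>
    let e : X ≃ₗ[R] X ⧸ (Ideal.ofList ([] : List R) • ⊤ : Submodule R X) :=
      (Submodule.quotEquivOfEqBot _ (by rw [Ideal.ofList_nil, Submodule.bot_smul])).symm
    exact (h n).of_iso ((tensorChainComplex P.complex).mapIso e.toModuleIso)
  | cons r rs ih =>
    rw [isWeaklyRegular_cons_iff] at hX hXY
    refine (ih (ModuleCat.of R (QuotSMulTop r X)) hX.2 ?_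
      (tensorChainComplex_exactAt_quotSMulTop P X r hX.1 hXY.1 h)).of_iso
      ((tensorChainComplex P.complex).mapIso
        (Submodule.quotOfListConsSMulTopEquivQuotSMulTopInner X r rs).symm.toModuleIso)
    exact ((QuotSMulTop.quotSMulTopTensorEquivQuotSMulTop r Y X).isWeaklyRegular_congr rs).mpr hXY.2

/-- If `rs` is weakly regular on the flat module `X` and on `X ⊗ Y`, then the higher `Tor` of
`X ⧸ (rs) X` and `Y` vanishes. -/
lemma subsingleton_tor_quot_ofList (rs : List R) (X Y : ModuleCat.{u} R) [Module.Flat R X]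
    (hX : IsWeaklyRegular X rs) (hXY : IsWeaklyRegular (X ⊗[R] Y) rs) (n : ℕ) :
    Subsingleton (((Tor (ModuleCat.{u} R) (n + 1)).obj
      (ModuleCat.of R (X ⧸ (Ideal.ofList rs • ⊤ : Submodule R X)))).obj Y) := by
  let P := projectiveResolution Y
  refine ModuleCat.subsingleton_of_isZero (Limits.IsZero.of_iso ?_
    (torIsoHomologyTensorChainComplex P _ (n + 1)))
  rw [← HomologicalComplex.exactAt_iff_isZero_homology]
  exact tensorChainComplex_exactAt_quot_ofList P rs X hX hXY
    (tensorChainComplex_exactAt_of_flat P X) n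

end TorRegular

/-- Let `R` be a commutative Noetherian local ring and suppose the concatenated sequence
`x_1, …, x_r, y_1, …, y_s` of elements of `R` is a regular sequence. Then
`Tor_i^R(R/(x_1,…,x_r), R/(y_1,…,y_s)) = 0` for all `i ≥ 1`. -/
theorem stmt_7 (R : Type) [CommRing R] [IsNoetherianRing R] [IsLocalRing R]
    (xs ys : List R) (h : RingTheory.Sequence.IsRegular R (xs ++ ys)) :
    ∀ i : ℕ, 1 ≤ i →
      Subsingleton
        (((Tor (ModuleCat R) i).obj (ModuleCat.of R (R ⧸ Ideal.ofList xs))).obj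
          (ModuleCat.of R (R ⧸ Ideal.ofList ys))) := by
  intro i hi
  obtain ⟨n, rfl⟩ := Nat.exists_eq_add_of_le' hi
  have hxs := ((RingTheory.Sequence.isWeaklyRegular_append_iff R xs ys).mp
    h.toIsWeaklyRegular).1
  have hys := ((RingTheory.Sequence.isWeaklyRegular_append_iff R ys xs).mp
    (IsLocalRing.isRegular_of_perm h List.perm_append_comm).toIsWeaklyRegular).2
  have key := subsingleton_tor_quot_ofList xs (ModuleCat.of R R)
    (ModuleCat.of R (R ⧸ Ideal.ofList ys)) hxs
    (((TensorProduct.lid R _).isWeaklyRegular_congr xs).mpr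
      (by rwa [smul_eq_mul, Ideal.mul_top] at hys)) n
  rwa [smul_eq_mul, Ideal.mul_top] at key
end

section
/- Let R be a commutative Noetherian local ring and I an ideal of R generated by a regular sequence x_1, …, x_r. Then for every p ≥ 0 the R/I-module I^p/I^{p+1} is free of rank equal to the binomial coefficient C(r + p − 1, p); equivalently, I^p/I^{p+1} is isomorphic to the p-th symmetric power of the free R/I-module I/I² of rank r. -/
/-- A finite family of elements of `R` generates `I ^ p` and its classes are linearly independent
over `R ⧸ I` in `I ^ p ⧸ I ^ (p + 1)`. -/
structure IsBasisModPow {R ι : Type*} [CommRing R] [Fintype ι] (I : Ideal R) (p : ℕ)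
    (m : ι → R) : Prop where
  span_eq : Ideal.span (Set.range m) = I ^ p
  coeff_mem : ∀ c : ι → R, ∑ i, c i * m i ∈ I ^ (p + 1) → ∀ i, c i ∈ I

namespace IsBasisModPow

variable {R ι κ : Type*} [CommRing R] [Fintype ι] [Fintype κ] {I J : Ideal R} {p : ℕ}
  {m : ι → R}

lemma mem (h : IsBasisModPow I p m) (i : ι) : m i ∈ I ^ p :=
  h.span_eq ▸ Ideal.subset_span ⟨i, rfl⟩

lemma mem_pow_iff (h : IsBasisModPow I p m) {y : R} :
    y ∈ I ^ p ↔ ∃ c : ι → R, ∑ i, c i * m i = y := by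
  rw [← h.span_eq, Ideal.mem_span_range_iff_exists_fun]

lemma sum_mem_pow_succ (h : IsBasisModPow I p m) {c : ι → R} (hc : ∀ i, c i ∈ I) :
    ∑ i, c i * m i ∈ I ^ (p + 1) :=
  sum_mem fun i _ ↦ pow_succ' I p ▸ Ideal.mul_mem_mul (hc i) (h.mem i)

lemma reindex (h : IsBasisModPow I p m) (e : κ ≃ ι) : IsBasisModPow I p (m ∘ e) where
  span_eq := by rw [e.surjective.range_comp, h.span_eq]
  coeff_mem c hc i := by
    have := h.coeff_mem (c ∘ e.symm) (by
      rw [← e.sum_comp]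
      simpa using hc) (e i)
    simpa using this

lemma zero [Unique ι] (I : Ideal R) : IsBasisModPow I 0 (fun _ : ι ↦ 1) where
  span_eq := by simp
  coeff_mem c hc i := by simpa [Subsingleton.elim i default] using hc

lemma bot_succ [IsEmpty ι] (m : ι → R) : IsBasisModPow (⊥ : Ideal R) (p + 1) m where
  span_eq := by rw [Set.range_eq_empty, Ideal.span_empty, pow_succ, Ideal.mul_bot]
  coeff_mem _ _ i := isEmptyElim i

/-- If every `J ^ q ⧸ J ^ (q + 1)` is free over `R ⧸ J`, then an element that is regular
modulo `J` is regular modulo every power of `J`. -/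
lemma mem_pow_of_mul_mem {ι : ℕ → Type*} [∀ q, Fintype (ι q)] {m : ∀ q, ι q → R}
    (h : ∀ q, IsBasisModPow J q (m q)) {x : R} (hx : ∀ y, x * y ∈ J → y ∈ J) (q : ℕ) :
    ∀ y, x * y ∈ J ^ q → y ∈ J ^ q := by
  induction q with
  | zero => simp
  | succ q ih =>
    intro y hy
    obtain ⟨c, rfl⟩ := (h q).mem_pow_iff.1 (ih y (Ideal.pow_le_pow_right q.le_succ hy))
    refine (h q).sum_mem_pow_succ fun i ↦ hx _ ((h q).coeff_mem (fun i ↦ x * c i) ?_ i)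
    simpa [Finset.mul_sum, mul_assoc] using hy

end IsBasisModPow

lemma Ideal.sup_span_singleton_pow_succ {R : Type*} [CommRing R] (J : Ideal R) (x : R) (p : ℕ) :
    (J ⊔ Ideal.span {x}) ^ (p + 1) =
      J ^ (p + 1) ⊔ Ideal.span {x} * (J ⊔ Ideal.span {x}) ^ p := by
  induction p with
  | zero => simp
  | succ p ih =>
    refine le_antisymm ?_ (sup_le (Ideal.pow_right_mono le_sup_left _) ?_)
    · rw [pow_succ' _ (p + 1), Ideal.sup_mul]
      refine sup_le ?_ le_sup_right
      conv_lhs => rw [ih]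
      rw [Ideal.mul_sup, ← pow_succ']
      refine sup_le_sup_left ?_ _
      rw [mul_left_comm, pow_succ' _ p]
      exact Ideal.mul_mono_right (Ideal.mul_mono_left le_sup_left)
    · rw [pow_succ' _ (p + 1)]
      exact Ideal.mul_mono_left le_sup_right

lemma IsBasisModPow.sumElim {R ι κ : Type*} [CommRing R] [Fintype ι] [Fintype κ] {J : Ideal R}
    {x : R} {p : ℕ} {m : ι → R} {n : κ → R} (hm : IsBasisModPow J (p + 1) m)
    (hn : IsBasisModPow (J ⊔ Ideal.span {x}) p n)
    (hx : ∀ y, x * y ∈ J ^ (p + 1) → y ∈ J ^ (p + 1)) :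
    IsBasisModPow (J ⊔ Ideal.span {x}) (p + 1) (Sum.elim m (fun j ↦ x * n j)) where
  span_eq := by
    rw [Set.Sum.elim_range, Ideal.span_union, hm.span_eq, Ideal.sup_span_singleton_pow_succ,
      ← hn.span_eq, Ideal.span_mul_span', Set.singleton_mul, ← Set.range_comp]
    rfl
  coeff_mem c hc := by
    rw [Ideal.sup_span_singleton_pow_succ, Submodule.mem_sup] at hc
    obtain ⟨u, hu, w, hw, huw⟩ := hc
    obtain ⟨v, hv, rfl⟩ := Ideal.mem_span_singleton_mul.1 hw
    rw [Fintype.sum_sum_type] at huw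
    simp only [Sum.elim_inl, Sum.elim_inr, mul_left_comm _ x, ← Finset.mul_sum] at huw
    have hdiff : ∑ j, c (.inr j) * n j - v ∈ J ^ (p + 1) := by
      refine hx _ ?_
      have : x * (∑ j, c (.inr j) * n j - v) = u - ∑ i, c (.inl i) * m i := by
        linear_combination -huw
      rw [this]
      refine sub_mem (Ideal.pow_le_pow_right (Nat.le_succ _) hu) (hm.mem_pow_iff.2 ⟨_, rfl⟩)
    obtain ⟨e, he⟩ := hm.mem_pow_iff.1 hdiff
    rintro (i | j)
    · have hi := hm.coeff_mem (fun i ↦ c (.inl i) + x * e i) (by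
        simp only [add_mul, Finset.sum_add_distrib, mul_assoc, ← Finset.mul_sum, he]
        convert hu using 1
        linear_combination -huw) i
      have hxe : x * e i ∈ J ⊔ Ideal.span {x} := Ideal.mul_mem_right _ _
        (Ideal.mem_sup_right (Ideal.mem_span_singleton_self x))
      exact (add_mem_cancel_right hxe).1 (Ideal.mem_sup_left hi)
    · refine hn.coeff_mem (fun j ↦ c (.inr j)) ?_ j
      rw [← sub_add_cancel (∑ j, c (.inr j) * n j) v]
      exact add_mem (Ideal.pow_right_mono le_sup_left _ hdiff) hv

theorem RingTheory.Sequence.IsWeaklyRegular.exists_isBasisModPow {R : Type*} [CommRing R]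
    {xs : List R} (h : IsWeaklyRegular R xs) (p : ℕ) :
    ∃ m : Fin (xs.length.multichoose p) → R, IsBasisModPow (Ideal.ofList xs) p m := by
  induction xs using List.reverseRecOn generalizing p with
  | nil =>
    rw [Ideal.ofList_nil, List.length_nil]
    cases p with
    | zero =>
      rw [Nat.multichoose_zero_right]
      exact ⟨_, .zero _⟩
    | succ p =>
      have : IsEmpty (Fin (Nat.multichoose 0 (p + 1))) := by
        rw [Nat.multichoose_zero_succ]; infer_instance
      exact ⟨isEmptyElim, .bot_succ _⟩
  | append_singleton xs x ih =>
    obtain ⟨hxs, hx⟩ := (isWeaklyRegular_append_iff R xs [x]).1 h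
    rw [isWeaklyRegular_singleton_iff, isSMulRegular_quotient_iff_mem_of_smul_mem] at hx
    simp only [smul_eq_mul, Ideal.mul_top] at hx
    choose m hm using ih hxs
    rw [Ideal.ofList_append, Ideal.ofList_singleton, List.length_append, List.length_singleton]
    induction p with
    | zero =>
      rw [Nat.multichoose_zero_right]
      exact ⟨_, .zero _⟩
    | succ p ihp =>
      obtain ⟨n, hn⟩ := ihp
      rw [Nat.multichoose_succ_succ]
      exact ⟨_, ((hm (p + 1)).sumElim hn
        (IsBasisModPow.mem_pow_of_mul_mem hm hx _)).reindex finSumFinEquiv.symm⟩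

theorem IsBasisModPow.nonempty_linearEquiv {R ι : Type*} [CommRing R] [Fintype ι] {I : Ideal R}
    {p : ℕ} {m : ι → R} (h : IsBasisModPow I p m) :
    Nonempty ((↥(I ^ p) ⧸ Submodule.comap (I ^ p).subtype (I ^ (p + 1))) ≃ₗ[R] (ι → R ⧸ I)) := by
  classical
  let f : (ι → R) →ₗ[R] ↥(I ^ p) := Fintype.linearCombination R fun i ↦ ⟨m i, h.mem i⟩
  have hf (c : ι → R) : (f c : R) = ∑ i, c i * m i := by
    simp [f, Fintype.linearCombination_apply]
  let g := (Submodule.comap (I ^ p).subtype (I ^ (p + 1))).mkQ ∘ₗ f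
  have hg : Function.Surjective g := by
    refine (Submodule.mkQ_surjective _).comp fun y ↦ ?_
    obtain ⟨c, hc⟩ := h.mem_pow_iff.1 y.2
    exact ⟨c, Subtype.ext ((hf c).trans hc)⟩
  have hker : LinearMap.ker g = Submodule.pi Set.univ fun _ ↦ I := by
    ext c
    have : c ∈ LinearMap.ker g ↔ ∑ i, c i * m i ∈ I ^ (p + 1) := by
      simp [g, Submodule.Quotient.mk_eq_zero, hf]
    rw [this, Submodule.mem_pi]
    exact ⟨fun hc i _ ↦ h.coeff_mem c hc i, fun hc ↦ h.sum_mem_pow_succ fun i ↦ hc i trivial⟩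
  exact ⟨(g.quotKerEquivOfSurjective hg).symm ≪≫ₗ Submodule.quotEquivOfEq _ _ hker ≪≫ₗ
    Submodule.quotientPi _⟩


/-- Let `R` be a commutative Noetherian local ring and `I` an ideal generated by a regular
sequence `x_1, …, x_r`. Then for every `p ≥ 0`, the `R/I`-module `I^p/I^{p+1}` is free of
rank `C(r + p - 1, p)`; that is, `I^p/I^{p+1}` is isomorphic to a direct sum of
`C(r + p - 1, p)` copies of `R/I`. -/
theorem stmt_8 (R : Type) [CommRing R] [IsNoetherianRing R] [IsLocalRing R]
    (xs : List R) (h : RingTheory.Sequence.IsRegular R xs) (r : ℕ) (hr : xs.length = r)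
    (I : Ideal R) (hI : I = Ideal.ofList xs) :
    ∀ p : ℕ,
      Nonempty
        ((↥(I ^ p) ⧸ Submodule.comap (I ^ p).subtype (I ^ (p + 1))) ≃ₗ[R]
          (Fin ((r + p - 1).choose p) → R ⧸ I)) := by
  intro p
  subst hr hI
  rw [← Nat.multichoose_eq]
  obtain ⟨m, hm⟩ := h.toIsWeaklyRegular.exists_isBasisModPow p
  exact hm.nonempty_linearEquiv
end

section
/- Let K be a field and x_0, …, x_N pairwise distinct elements of K. Then for every natural number m: if m < N, the sum Σ_{i=0}^N x_i^m · Π_{j≠i} (x_i − x_j)^{-1} equals 0; and if m ≥ N, it equals the complete homogeneous symmetric function Σ_{a} x_0^{a_0} x_1^{a_1} ⋯ x_N^{a_N}, where the sum runs over all tuples a = (a_0,…,a_N) of natural numbers with a_0 + … + a_N = m − N. -/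
/-- Summing over the exponent of the first variable. -/
theorem sum_antidiagonalTuple_succ_prod_pow {R : Type*} [CommSemiring R] (n k : ℕ)
    (x : Fin (n + 1) → R) :
    ∑ a ∈ Finset.Nat.antidiagonalTuple (n + 1) k, ∏ i, x i ^ a i =
      ∑ p ∈ Finset.HasAntidiagonal.antidiagonal k, x 0 ^ p.1 *
        ∑ b ∈ Finset.Nat.antidiagonalTuple n p.2, ∏ i, x (Fin.succ i) ^ b i := by
  simp_rw [Finset.mul_sum]
  rw [Finset.sum_sigma']
  refine Finset.sum_bij' (fun a _ => ⟨(a 0, ∑ i, a (Fin.succ i)), fun i => a (Fin.succ i)⟩)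
    (fun q _ => Fin.cons q.1.1 q.2) ?_ ?_ ?_ ?_ ?_
  · intro a ha
    simpa [Finset.Nat.mem_antidiagonalTuple, Fin.sum_univ_succ] using ha
  · rintro ⟨⟨p, q⟩, b⟩ h
    simp only [Finset.mem_sigma, Finset.HasAntidiagonal.mem_antidiagonal,
      Finset.Nat.mem_antidiagonalTuple] at h
    simp [Finset.Nat.mem_antidiagonalTuple, Fin.sum_univ_succ, h.2, h.1]
  · intro a _
    exact Fin.cons_self_tail a
  · rintro ⟨⟨p, q⟩, b⟩ h
    simp only [Finset.mem_sigma, Finset.HasAntidiagonal.mem_antidiagonal,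
      Finset.Nat.mem_antidiagonalTuple] at h
    obtain ⟨-, rfl⟩ := h
    simp
  · intro a _
    simp [Fin.prod_univ_succ]

/-- The recurrence `h_{k+1}(x₀, …, xₙ) = x₀ h_k(x₀, …, xₙ) + h_{k+1}(x₁, …, xₙ)`. -/
theorem sum_antidiagonalTuple_succ_succ_prod_pow {R : Type*} [CommSemiring R] (n k : ℕ)
    (x : Fin (n + 1) → R) :
    ∑ a ∈ Finset.Nat.antidiagonalTuple (n + 1) (k + 1), ∏ i, x i ^ a i =
      x 0 * ∑ a ∈ Finset.Nat.antidiagonalTuple (n + 1) k, ∏ i, x i ^ a i +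
        ∑ b ∈ Finset.Nat.antidiagonalTuple n (k + 1), ∏ i, x (Fin.succ i) ^ b i := by
  rw [sum_antidiagonalTuple_succ_prod_pow, sum_antidiagonalTuple_succ_prod_pow,
    Finset.Nat.sum_antidiagonal_succ, add_comm]
  simp [pow_succ', mul_assoc, ← Finset.mul_sum]

/-- The recurrence of divided differences of monomials obtained by removing the first node. -/
theorem sum_pow_succ_mul_prod_erase_inv {K : Type*} [Field K] (n m : ℕ) (x : Fin (n + 1) → K)
    (hx : Function.Injective x) :
    ∑ i, x i ^ (m + 1) * (∏ j ∈ Finset.univ.erase i, (x i - x j))⁻¹ =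
      x 0 * ∑ i, x i ^ m * (∏ j ∈ Finset.univ.erase i, (x i - x j))⁻¹ +
        ∑ i : Fin n, x i.succ ^ m *
          (∏ j ∈ Finset.univ.erase i, (x i.succ - x j.succ))⁻¹ := by
  have key (i : Fin n) : ∏ j ∈ Finset.univ.erase i.succ, (x i.succ - x j) =
      (x i.succ - x 0) * ∏ j ∈ Finset.univ.erase i, (x i.succ - x j.succ) := by
    have h : (Finset.univ.erase i.succ : Finset (Fin (n + 1))) =
        Finset.cons 0 ((Finset.univ.erase i).map (Fin.succEmb n)) (by simp) := by
      ext j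
      refine Fin.cases ?_ (fun j => ?_) j <;> simp [Fin.succ_ne_zero, (Fin.succ_ne_zero _).symm]
    rw [h, Finset.prod_cons, Finset.prod_map]
    rfl
  rw [Fin.sum_univ_succ, Fin.sum_univ_succ (n := n), mul_add, Finset.mul_sum, add_assoc,
    ← Finset.sum_add_distrib]
  congr 1
  · ring
  · refine Finset.sum_congr rfl fun i _ => ?_
    have h0 : x i.succ - x 0 ≠ 0 := sub_ne_zero.2 (hx.ne (Fin.succ_ne_zero i))
    rw [key, mul_inv]
    field_simp
    ring

/-- The divided difference of `X ^ m` at `n + 1` nodes, for `m ≤ n`, is the coefficient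
of degree `n`. -/
theorem sum_pow_mul_prod_erase_inv_of_le {K : Type*} [Field K] {n m : ℕ} (x : Fin (n + 1) → K)
    (hx : Function.Injective x) (hm : m ≤ n) :
    ∑ i, x i ^ m * (∏ j ∈ Finset.univ.erase i, (x i - x j))⁻¹ = if n = m then 1 else 0 := by
  have h := Lagrange.coeff_eq_sum (s := Finset.univ) (v := x) hx.injOn
    (P := (Polynomial.X ^ m : Polynomial K)) (by simpa using mod_cast Nat.lt_succ_of_le hm)
  simpa [Polynomial.coeff_X_pow, div_eq_mul_inv] using h.symm

/-- The divided difference of `X ^ (n + k)` at `n + 1` nodes is the complete homogeneous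
symmetric function of degree `k`. -/
theorem sum_pow_add_mul_prod_erase_inv {K : Type*} [Field K] (n k : ℕ) (x : Fin (n + 1) → K)
    (hx : Function.Injective x) :
    ∑ i, x i ^ (n + k) * (∏ j ∈ Finset.univ.erase i, (x i - x j))⁻¹ =
      ∑ a ∈ Finset.Nat.antidiagonalTuple (n + 1) k, ∏ i, x i ^ a i := by
  induction n generalizing k with
  | zero => simp
  | succ n ihn =>
    induction k with
    | zero =>
      rw [add_zero, sum_pow_mul_prod_erase_inv_of_le x hx le_rfl]
      simp [Finset.Nat.antidiagonalTuple_zero_right]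
    | succ k ihk =>
      rw [← add_assoc, sum_pow_succ_mul_prod_erase_inv _ _ x hx, ihk,
        sum_antidiagonalTuple_succ_succ_prod_pow,
        ← ihn (k + 1) (fun i => x i.succ) (hx.comp (Fin.succ_injective _)),
        show n + 1 + k = n + (k + 1) by ring]

/-- Let `K` be a field and `x 0, …, x N` pairwise distinct elements of `K`. Then for every
natural number `m`: if `m < N`, the sum `∑ i, x i ^ m * ∏_{j ≠ i} (x i - x j)⁻¹` equals `0`;
and if `m ≥ N`, it equals the complete homogeneous symmetric function of degree `m - N`,
i.e. the sum of `∏ i, x i ^ a i` over all tuples `a` of naturals with `∑ i, a i = m - N`. -/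
theorem stmt_10 (K : Type) [Field K] (N : ℕ) (x : Fin (N + 1) → K)
    (hx : Function.Injective x) (m : ℕ) :
    (m < N →
      ∑ i, x i ^ m * (∏ j ∈ Finset.univ.erase i, (x i - x j))⁻¹ = 0) ∧
    (N ≤ m →
      ∑ i, x i ^ m * (∏ j ∈ Finset.univ.erase i, (x i - x j))⁻¹ =
        ∑ a ∈ Finset.Nat.antidiagonalTuple (N + 1) (m - N), ∏ i, x i ^ a i) := by
  constructor
  · intro h
    rw [sum_pow_mul_prod_erase_inv_of_le x hx h.le, if_neg h.ne']
  · intro h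
    obtain ⟨k, rfl⟩ := Nat.exists_eq_add_of_le h
    rw [Nat.add_sub_cancel_left]
    exact sum_pow_add_mul_prod_erase_inv N k x hx
end

section
/- Let w_0, …, w_N be pairwise distinct integers and l ≥ 0 a natural number. Then in the field ℚ(λ) of rational functions in one variable λ, the identity Σ_{i=0}^N λ^{l·w_i} · Π_{j≠i} (1 − λ^{w_j − w_i})^{-1} = Σ_{a} λ^{a_0 w_0 + a_1 w_1 + … + a_N w_N} holds, where the sum on the right runs over all tuples a = (a_0,…,a_N) of natural numbers with a_0 + … + a_N = l. (This is the coherent Lefschetz fixed point formula for the sheaf O(l) on ℙ^N under the linear 𝔾_m-action with weights w_0,…,w_N: the left-hand side is the sum of local terms at the N+1 fixed points and the right-hand side is the trace of λ ∈ 𝔾_m acting on H^0(ℙ^N, O(l)), the space of degree-l forms.) -/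
theorem Finset.Nat.sum_antidiagonalTuple_succ {M : Type*} [AddCommMonoid M] (k n : ℕ)
    (f : (Fin (k + 1) → ℕ) → M) :
    ∑ a ∈ Finset.Nat.antidiagonalTuple (k + 1) n, f a =
      ∑ p ∈ Finset.HasAntidiagonal.antidiagonal n,
        ∑ b ∈ Finset.Nat.antidiagonalTuple k p.2, f (Fin.cons p.1 b) := by
  rw [Finset.sum_sigma']
  refine Finset.sum_bij' (fun a _ => ⟨(a 0, ∑ i, Fin.tail a i), Fin.tail a⟩)
    (fun x _ => Fin.cons x.1.1 x.2) ?_ ?_ ?_ ?_ ?_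
  · simp [Finset.Nat.mem_antidiagonalTuple, Fin.sum_univ_succ, Fin.tail]
  · simp +contextual [Finset.Nat.mem_antidiagonalTuple, Fin.sum_univ_succ]
  · simp
  · rintro ⟨⟨p, q⟩, b⟩ h
    obtain rfl : ∑ i, b i = q := by
      simpa [Finset.Nat.mem_antidiagonalTuple] using (Finset.mem_sigma.1 h).2
    simp
  · simp

/-- Complete homogeneous sums satisfy `h_{l+1}(v) = v₀ h_l(v) + h_{l+1}(tail v)`. -/
theorem sum_antidiagonalTuple_prod_pow_succ {R : Type*} [CommSemiring R] (n l : ℕ)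
    (v : Fin (n + 1) → R) :
    ∑ a ∈ Finset.Nat.antidiagonalTuple (n + 1) (l + 1), ∏ i, v i ^ a i =
      v 0 * ∑ a ∈ Finset.Nat.antidiagonalTuple (n + 1) l, ∏ i, v i ^ a i +
        ∑ a ∈ Finset.Nat.antidiagonalTuple n (l + 1), ∏ i, v i.succ ^ a i := by
  simp only [Finset.Nat.sum_antidiagonalTuple_succ, Finset.Nat.sum_antidiagonal_succ,
    Fin.prod_univ_succ, Fin.cons_zero, Fin.cons_succ, pow_zero, one_mul, Finset.mul_sum, pow_succ']
  simp only [mul_assoc, add_comm]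

theorem sum_pow_div_prod_sub_succ {K : Type*} [Field K] (n m : ℕ) (v : Fin (n + 1) → K)
    (hv : Function.Injective v) :
    ∑ i, v i ^ (m + 1) / ∏ j ∈ Finset.univ.erase i, (v i - v j) =
      v 0 * ∑ i, v i ^ m / ∏ j ∈ Finset.univ.erase i, (v i - v j) +
        ∑ i : Fin n, v i.succ ^ m /
          ∏ j ∈ Finset.univ.erase i, (v i.succ - v j.succ) := by
  rw [Fin.sum_univ_succ, Fin.sum_univ_succ (fun i => v i ^ m / _), mul_add, add_assoc,
    Finset.mul_sum, ← Finset.sum_add_distrib]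
  congr 1
  · ring
  refine Finset.sum_congr rfl fun i _ => ?_
  have h0 : v i.succ - v 0 ≠ 0 := sub_ne_zero.2 (hv.ne (Fin.succ_ne_zero i))
  have hprod : ∏ j ∈ Finset.univ.erase i.succ, (v i.succ - v j) =
      (v i.succ - v 0) * ∏ j ∈ Finset.univ.erase i, (v i.succ - v j.succ) := by
    have : (Finset.univ.erase i.succ : Finset (Fin (n + 1))) =
        Finset.cons 0 ((Finset.univ.erase i).map (Fin.succEmb n)) (by simp) := by
      ext j
      refine Fin.cases ?_ (fun j => ?_) j <;> simp [(Fin.succ_ne_zero _).symm]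
    rw [this, Finset.prod_cons, Finset.prod_map]
    rfl
  have h1 : ∏ j ∈ Finset.univ.erase i, (v i.succ - v j.succ) ≠ 0 :=
    Finset.prod_ne_zero_iff.2 fun j hj => sub_ne_zero.2 <|
      hv.ne fun h => Finset.ne_of_mem_erase hj (Fin.succ_injective _ h).symm
  rw [hprod]
  field_simp
  ring

/-- Sylvester's identity: the divided difference of `x ^ (l + n)` at `n + 1` distinct nodes is the
complete homogeneous sum of degree `l`. -/
theorem sum_pow_div_prod_sub {K : Type*} [Field K] (n l : ℕ) (v : Fin (n + 1) → K)
    (hv : Function.Injective v) :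
    ∑ i, v i ^ (l + n) / ∏ j ∈ Finset.univ.erase i, (v i - v j) =
      ∑ a ∈ Finset.Nat.antidiagonalTuple (n + 1) l, ∏ i, v i ^ a i := by
  induction n generalizing l with
  | zero => simp
  | succ n ihn =>
    induction l with
    | zero =>
      have h := Lagrange.coeff_eq_sum (s := Finset.univ) (P := Polynomial.X ^ (n + 1))
        hv.injOn (by simp; norm_cast; omega)
      simpa [Finset.Nat.antidiagonalTuple_zero_right] using h.symm
    | succ l ihl =>
      rw [sum_antidiagonalTuple_prod_pow_succ, ← ihl,
        ← ihn (l + 1) (fun i => v i.succ) (hv.comp (Fin.succ_injective _)),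
        show l + 1 + (n + 1) = l + (n + 1) + 1 by ring,
        sum_pow_div_prod_sub_succ _ _ _ hv, show l + (n + 1) = l + 1 + n by ring]

theorem sum_pow_mul_prod_one_sub_div_inv {K : Type*} [Field K] (n l : ℕ) (v : Fin (n + 1) → K)
    (hv : Function.Injective v) (h0 : ∀ i, v i ≠ 0) :
    ∑ i, v i ^ l * ∏ j ∈ Finset.univ.erase i, (1 - v j / v i)⁻¹ =
      ∑ a ∈ Finset.Nat.antidiagonalTuple (n + 1) l, ∏ i, v i ^ a i := by
  rw [← sum_pow_div_prod_sub n l v hv]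
  refine Finset.sum_congr rfl fun i _ => ?_
  have h (j) : (1 - v j / v i)⁻¹ = v i / (v i - v j) := by
    rw [one_sub_div (h0 i), inv_div]
  simp only [h, Finset.prod_div_distrib, Finset.prod_const]
  simp [pow_add, mul_div_assoc]

theorem zpow_sum₀ {ι K : Type*} [CommGroupWithZero K] {x : K} (hx : x ≠ 0) (s : Finset ι)
    (f : ι → ℤ) : x ^ (∑ i ∈ s, f i) = ∏ i ∈ s, x ^ f i := by
  classical
  induction s using Finset.induction_on with
  | empty => simp
  | insert i s hi ih => rw [Finset.sum_insert hi, Finset.prod_insert hi, zpow_add₀ hx, ih]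

theorem RatFunc.zpow_X_injective (K : Type*) [Field K] :
    Function.Injective fun n : ℤ => (RatFunc.X : RatFunc K) ^ n := by
  have key (k : ℕ) (h : (RatFunc.X : RatFunc K) ^ k = 1) : k = 0 := by
    rw [← RatFunc.algebraMap_X, ← map_pow, ← map_one (algebraMap (Polynomial K) (RatFunc K))] at h
    simpa using congrArg Polynomial.natDegree (RatFunc.algebraMap_injective K h)
  intro m n h
  have hd : (RatFunc.X : RatFunc K) ^ (m - n) = 1 := by
    rw [zpow_sub₀ RatFunc.X_ne_zero, div_eq_one_iff_eq (zpow_ne_zero _ RatFunc.X_ne_zero)]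
    exact h
  obtain ⟨k, hk | hk⟩ := Int.eq_nat_or_neg (m - n)
  · have := key k (by simpa [hk] using hd)
    omega
  · have := key k (by simpa [hk] using hd)
    omega

/-- Coherent Lefschetz fixed point formula for `O(l)` on `ℙ^N` with a linear `𝔾ₘ`-action of
pairwise distinct weights `w 0, …, w N`: in `ℚ(λ)`,
`∑ i, λ^(l * w i) * ∏_{j ≠ i} (1 - λ^(w j - w i))⁻¹`
equals `∑_a λ^(a 0 * w 0 + … + a N * w N)`, the sum over all tuples `a` of naturals with
`∑ i, a i = l`. -/
theorem stmt_11 (N : ℕ) (w : Fin (N + 1) → ℤ) (hw : Function.Injective w) (l : ℕ) :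
    ∑ i, (RatFunc.X : RatFunc ℚ) ^ ((l : ℤ) * w i) *
        ∏ j ∈ Finset.univ.erase i, (1 - (RatFunc.X : RatFunc ℚ) ^ (w j - w i))⁻¹ =
      ∑ a ∈ Finset.Nat.antidiagonalTuple (N + 1) l,
        (RatFunc.X : RatFunc ℚ) ^ (∑ i, (a i : ℤ) * w i) := by
  have hX : (RatFunc.X : RatFunc ℚ) ≠ 0 := RatFunc.X_ne_zero
  convert sum_pow_mul_prod_one_sub_div_inv N l (fun i => (RatFunc.X : RatFunc ℚ) ^ w i)
    ((RatFunc.zpow_X_injective ℚ).comp hw) (fun i => zpow_ne_zero _ hX) using 2 with i _ a _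
  · simp only [mul_comm (l : ℤ), zpow_mul, zpow_natCast, zpow_sub₀ hX]
  · simp only [zpow_sum₀ hX, mul_comm _ (w _), zpow_mul, zpow_natCast]
end

section
/- Let k be a field, A and B commutative k-algebras, M and M' modules over A, and N and N' modules over B. Then for every n ≥ 0 there is an isomorphism of k-vector spaces Tor_n^{A ⊗_k B}(M ⊗_k N, M' ⊗_k N') ≅ ⊕_{i+j=n} Tor_i^A(M, M') ⊗_k Tor_j^B(N, N'). -/
open CategoryTheory TensorProduct DirectSum

section

open Limits HomologicalComplex MonoidalCategory

namespace HomologicalComplex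

section comparison

variable {C₁ C₂ D E₁ E₂ E : Type*} [Category* C₁] [Category* C₂] [Category* D]
  [Category* E₁] [Category* E₂] [Category* E]
  [Preadditive C₁] [Preadditive C₂] [Preadditive D]
  [Preadditive E₁] [Preadditive E₂] [Preadditive E]
  {I₁ I₂ J : Type*} {c₁ : ComplexShape I₁} {c₂ : ComplexShape I₂}

section

variable (F : C₁ ⥤ C₂ ⥤ D) [F.PreservesZeroMorphisms] [∀ X, (F.obj X).PreservesZeroMorphisms]
  (c : ComplexShape J) [TotalComplexShape c₁ c₂ c] [DecidableEq J]

lemma mapBifunctorMap_id (K : HomologicalComplex C₁ c₁) (L : HomologicalComplex C₂ c₂)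
    [HasMapBifunctor K L F c] :
    mapBifunctorMap (𝟙 K) (𝟙 L) F c = 𝟙 _ := by
  ext n i j h
  simp

lemma mapBifunctorMap_comp {K K' K'' : HomologicalComplex C₁ c₁}
    {L L' L'' : HomologicalComplex C₂ c₂}
    [HasMapBifunctor K L F c] [HasMapBifunctor K' L' F c] [HasMapBifunctor K'' L'' F c]
    (f : K ⟶ K') (f' : K' ⟶ K'') (g : L ⟶ L') (g' : L' ⟶ L'') :
    mapBifunctorMap (f ≫ f') (g ≫ g') F c =
      mapBifunctorMap f g F c ≫ mapBifunctorMap f' g' F c := by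
  ext n i j h
  simp

end

/-- A homotopy between maps induced by homotopic morphisms in both variables. -/
noncomputable def mapBifunctorMapHomotopy
    (F : C₁ ⥤ C₂ ⥤ D) [F.Additive] [∀ X, (F.obj X).Additive]
    (c : ComplexShape J) [TotalComplexShape c₁ c₂ c] [DecidableEq J]
    {K K' : HomologicalComplex C₁ c₁} {L L' : HomologicalComplex C₂ c₂}
    [HasMapBifunctor K L F c] [HasMapBifunctor K' L' F c]
    {f f' : K ⟶ K'} {g g' : L ⟶ L'} (hf : Homotopy f f') (hg : Homotopy g g') :
    Homotopy (mapBifunctorMap f g F c) (mapBifunctorMap f' g' F c) :=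
  (mapBifunctorMapHomotopy₁ hf g F c).trans (mapBifunctorMapHomotopy₂ f' hg F c)

/-- The total complex of a bifunctor respects homotopy equivalences. -/
noncomputable def mapBifunctorHomotopyEquiv
    (F : C₁ ⥤ C₂ ⥤ D) [F.Additive] [∀ X, (F.obj X).Additive]
    (c : ComplexShape J) [TotalComplexShape c₁ c₂ c] [DecidableEq J]
    {K K' : HomologicalComplex C₁ c₁} {L L' : HomologicalComplex C₂ c₂}
    [HasMapBifunctor K L F c] [HasMapBifunctor K' L' F c]
    (e : HomotopyEquiv K K') (e' : HomotopyEquiv L L') :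
    HomotopyEquiv (mapBifunctor K L F c) (mapBifunctor K' L' F c) where
  hom := mapBifunctorMap e.hom e'.hom F c
  inv := mapBifunctorMap e.inv e'.inv F c
  homotopyHomInvId := (Homotopy.ofEq (mapBifunctorMap_comp ..).symm).trans
    ((mapBifunctorMapHomotopy F c e.homotopyHomInvId e'.homotopyHomInvId).trans
      (Homotopy.ofEq (mapBifunctorMap_id ..)))
  homotopyInvHomId := (Homotopy.ofEq (mapBifunctorMap_comp ..).symm).trans
    ((mapBifunctorMapHomotopy F c e.homotopyInvHomId e'.homotopyInvHomId).trans
      (Homotopy.ofEq (mapBifunctorMap_id ..)))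

section

variable {F : C₁ ⥤ C₂ ⥤ D} [F.PreservesZeroMorphisms] [∀ X, (F.obj X).PreservesZeroMorphisms]
  {H : E₁ ⥤ E₂ ⥤ E} [H.PreservesZeroMorphisms] [∀ X, (H.obj X).PreservesZeroMorphisms]
  {c : ComplexShape J} [TotalComplexShape c₁ c₂ c] [DecidableEq J]
  {G : D ⥤ E}
  {K : HomologicalComplex C₁ c₁} {L : HomologicalComplex C₂ c₂}
  {K₁ : HomologicalComplex E₁ c₁} {L₁ : HomologicalComplex E₂ c₂}
  [HasMapBifunctor K L F c] [HasMapBifunctor K₁ L₁ H c]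
  (α : ∀ i j, (H.obj (K₁.X i)).obj (L₁.X j) ≅ G.obj ((F.obj (K.X i)).obj (L.X j)))

/-- The components of the comparison between the total complex of a bicomplex
and the image by a functor of another total complex. -/
noncomputable def mapBifunctorComparisonF (n : J) :
    (mapBifunctor K₁ L₁ H c).X n ⟶ G.obj ((mapBifunctor K L F c).X n) :=
  mapBifunctorDesc fun i j h => (α i j).hom ≫ G.map (ιMapBifunctor K L F c i j n h)

@[simp]
lemma ι_mapBifunctorComparisonF (n : J) (i : I₁) (j : I₂)
    (h : ComplexShape.π c₁ c₂ c (i, j) = n) :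
    ιMapBifunctor K₁ L₁ H c i j n h ≫ mapBifunctorComparisonF α n =
      (α i j).hom ≫ G.map (ιMapBifunctor K L F c i j n h) :=
  ι_mapBifunctorDesc ..

lemma mapBifunctorComparisonF_comm [G.Additive]
    (hα₁ : ∀ i i' j, (H.map (K₁.d i i')).app (L₁.X j) ≫ (α i' j).hom =
      (α i j).hom ≫ G.map ((F.map (K.d i i')).app (L.X j)))
    (hα₂ : ∀ i j j', (H.obj (K₁.X i)).map (L₁.d j j') ≫ (α i j').hom =
      (α i j).hom ≫ G.map ((F.obj (K.X i)).map (L.d j j'))) (n m : J) :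
    mapBifunctorComparisonF α n ≫ G.map ((mapBifunctor K L F c).d n m) =
      (mapBifunctor K₁ L₁ H c).d n m ≫ mapBifunctorComparisonF α m := by
  ext i j h
  simp only [mapBifunctor.d_eq, Preadditive.add_comp, Preadditive.comp_add, Functor.map_add,
    reassoc_of% (ι_mapBifunctorComparisonF α), mapBifunctor.ι_D₁_assoc, mapBifunctor.ι_D₂_assoc,
    ← Functor.map_comp, mapBifunctor.ι_D₁, mapBifunctor.ι_D₂]
  congr 1
  · by_cases hi : c₁.Rel i (c₁.next i)
    · by_cases hm : ComplexShape.π c₁ c₂ c (c₁.next i, j) = m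
      · rw [mapBifunctor.d₁_eq _ _ _ _ hi _ _ hm, mapBifunctor.d₁_eq _ _ _ _ hi _ _ hm]
        simp only [Linear.units_smul_comp, Category.assoc, ι_mapBifunctorComparisonF,
          Functor.map_units_smul, Linear.comp_units_smul, Functor.map_comp,
          reassoc_of% (hα₁ i (c₁.next i) j)]
      · rw [mapBifunctor.d₁_eq_zero' _ _ _ _ hi _ _ hm,
          mapBifunctor.d₁_eq_zero' _ _ _ _ hi _ _ hm]
        simp
    · rw [mapBifunctor.d₁_eq_zero _ _ _ _ _ _ _ hi, mapBifunctor.d₁_eq_zero _ _ _ _ _ _ _ hi]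
      simp
  · by_cases hi : c₂.Rel j (c₂.next j)
    · by_cases hm : ComplexShape.π c₁ c₂ c (i, c₂.next j) = m
      · rw [mapBifunctor.d₂_eq _ _ _ _ _ hi _ hm, mapBifunctor.d₂_eq _ _ _ _ _ hi _ hm]
        simp only [Linear.units_smul_comp, Category.assoc, ι_mapBifunctorComparisonF,
          Functor.map_units_smul, Linear.comp_units_smul, Functor.map_comp,
          reassoc_of% (hα₂ i j (c₂.next j))]
      · rw [mapBifunctor.d₂_eq_zero' _ _ _ _ _ hi _ hm,
          mapBifunctor.d₂_eq_zero' _ _ _ _ _ hi _ hm]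
        simp
    · rw [mapBifunctor.d₂_eq_zero _ _ _ _ _ _ _ hi, mapBifunctor.d₂_eq_zero _ _ _ _ _ _ _ hi]
      simp

variable (K L F c) in
/-- The degreewise coproduct decomposition of `mapBifunctor K L F c`. -/
noncomputable def isColimitMapBifunctorCofan (n : J) :
    IsColimit (Cofan.mk ((mapBifunctor K L F c).X n)
      fun i : (ComplexShape.π c₁ c₂ c) ⁻¹' {n} => ιMapBifunctor K L F c i.1.1 i.1.2 n i.2) :=
  GradedObject.isColimitCofanMapObj
    ((((F.mapBifunctorHomologicalComplex c₁ c₂).obj K).obj L).toGradedObject) _ n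

lemma isIso_mapBifunctorComparisonF (n : J)
    [PreservesColimitsOfShape (Discrete ((ComplexShape.π c₁ c₂ c) ⁻¹' {n})) G] :
    IsIso (mapBifunctorComparisonF (c := c) α n) := by
  have hc := isColimitCofanMkObjOfIsColimit G _ _ (isColimitMapBifunctorCofan F c K L n)
  refine ⟨Cofan.IsColimit.desc hc fun i => (α _ _).inv ≫
    ιMapBifunctor K₁ L₁ H c i.1.1 i.1.2 n i.2, ?_, ?_⟩
  · ext i j h
    have := Cofan.IsColimit.fac hc (fun i => (α _ _).inv ≫
      ιMapBifunctor K₁ L₁ H c i.1.1 i.1.2 n i.2) ⟨(i, j), h⟩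
    rw [reassoc_of% (ι_mapBifunctorComparisonF α), Category.comp_id, ← Iso.eq_inv_comp]
    exact this
  · refine Cofan.IsColimit.hom_ext hc _ _ fun ⟨⟨i, j⟩, h⟩ => ?_
    have := (α i j).inv ≫= ι_mapBifunctorComparisonF (c := c) α n i j h
    rw [Iso.inv_hom_id_assoc] at this
    rw [Cofan.IsColimit.fac_assoc, Category.assoc]
    exact this.trans (Category.comp_id _).symm

/-- The comparison between the total complex of a bicomplex
and the image by a functor of another total complex. -/
noncomputable def mapBifunctorComparison [G.Additive]
    [∀ n, PreservesColimitsOfShape (Discrete ((ComplexShape.π c₁ c₂ c) ⁻¹' {n})) G]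
    (hα₁ : ∀ i i' j, (H.map (K₁.d i i')).app (L₁.X j) ≫ (α i' j).hom =
      (α i j).hom ≫ G.map ((F.map (K.d i i')).app (L.X j)))
    (hα₂ : ∀ i j j', (H.obj (K₁.X i)).map (L₁.d j j') ≫ (α i j').hom =
      (α i j).hom ≫ G.map ((F.obj (K.X i)).map (L.d j j'))) :
    mapBifunctor K₁ L₁ H c ≅ (G.mapHomologicalComplex c).obj (mapBifunctor K L F c) :=
  Hom.isoOfComponents
    (fun n => @asIso _ _ _ _ _ (isIso_mapBifunctorComparisonF α n))
    (fun n m _ => mapBifunctorComparisonF_comm α hα₁ hα₂ n m)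

lemma mapBifunctorMap_comp_comparisonF
    {K' : HomologicalComplex C₁ c₁} {L' : HomologicalComplex C₂ c₂}
    {K₁' : HomologicalComplex E₁ c₁} {L₁' : HomologicalComplex E₂ c₂}
    [HasMapBifunctor K' L' F c] [HasMapBifunctor K₁' L₁' H c]
    (α' : ∀ i j, (H.obj (K₁'.X i)).obj (L₁'.X j) ≅ G.obj ((F.obj (K'.X i)).obj (L'.X j)))
    (f : K ⟶ K') (g : L ⟶ L') (f₁ : K₁ ⟶ K₁') (g₁ : L₁ ⟶ L₁')
    (hα : ∀ i j, (H.map (f₁.f i)).app (L₁.X j) ≫ (H.obj (K₁'.X i)).map (g₁.f j) ≫ (α' i j).hom =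
      (α i j).hom ≫ G.map ((F.map (f.f i)).app (L.X j) ≫ (F.obj (K'.X i)).map (g.f j))) (n : J) :
    (mapBifunctorMap f₁ g₁ H c).f n ≫ mapBifunctorComparisonF α' n =
      mapBifunctorComparisonF α n ≫ G.map ((mapBifunctorMap f g F c).f n) := by
  ext i j h
  rw [ι_mapBifunctorMap_assoc, ι_mapBifunctorComparisonF,
    reassoc_of% (ι_mapBifunctorComparisonF α), ← G.map_comp, ι_mapBifunctorMap,
    reassoc_of% (hα i j)]
  simp only [Functor.map_comp, Category.assoc]

end

end comparison

end HomologicalComplex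

namespace HomologicalComplex

section regular

variable {V ι : Type*} [Category* V] [Preadditive V] [CategoryWithHomology V]
  {c : ComplexShape ι} (K : HomologicalComplex V c)

/-- The homology of a complex, regarded as a complex with zero differentials. -/
noncomputable abbrev homologyComplex : HomologicalComplex V c where
  X i := K.homology i
  d _ _ := 0

variable {K} (p : K ⟶ K) (hp : ∀ i j, p.f i ≫ K.d i j = 0)

/-- The map to the homology induced by an endomorphism `p` such that `p ≫ d = 0`. -/
noncomputable def toHomologyComplex : K ⟶ K.homologyComplex where
  f i := K.liftCycles (p.f i) _ rfl (hp i _) ≫ K.homologyπ i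
  comm' i j _ := by
    have : K.d i j ≫ K.liftCycles (p.f j) _ rfl (hp j _) = 0 := by
      simp [← cancel_mono (K.iCycles j), ← p.comm, hp]
    simp [reassoc_of% this]

/-- The map from the homology induced by an endomorphism `p` such that `p ≫ d = 0`. -/
noncomputable def fromHomologyComplex : K.homologyComplex ⟶ K where
  f i := K.homologyι i ≫ K.descOpcycles (p.f i) _ rfl (by rw [← p.comm, hp])
  comm' i j _ := by
    have : K.descOpcycles (p.f i) _ rfl (by rw [← p.comm, hp]) ≫ K.d i j = 0 := by
      simp [← cancel_epi (K.pOpcycles i), hp]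
    simp [this]

lemma toHomologyComplex_comp_from :
    toHomologyComplex p hp ≫ fromHomologyComplex p hp = p ≫ p := by
  ext i
  simp [toHomologyComplex, fromHomologyComplex]

lemma fromHomologyComplex_comp_to (h : Homotopy p (𝟙 K)) :
    fromHomologyComplex p hp ≫ toHomologyComplex p hp = 𝟙 _ := by
  ext i
  have h₁ : K.iCycles i ≫ p.f i ≫ K.liftCycles (p.f i) _ rfl (hp i _) =
      cyclesMap (p ≫ p) i := by
    simp [← cancel_mono (K.iCycles i)]
  have h₂ : homologyMap (p ≫ p) i = 𝟙 _ := by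
    rw [homologyMap_comp, h.homologyMap_eq, homologyMap_id, Category.comp_id]
  have : (K.homologyι i ≫ K.descOpcycles (p.f i) _ rfl (by rw [← p.comm, hp])) ≫
      K.liftCycles (p.f i) _ rfl (hp i _) ≫ K.homologyπ i = 𝟙 _ := by
    rw [← cancel_epi (K.homologyπ i), Category.assoc, homology_π_ι_assoc, p_descOpcycles_assoc,
      reassoc_of% h₁, ← homologyπ_naturality, h₂]
  exact this

/-- A complex with an idempotent-like endomorphism `p`, homotopic to the identity and
annihilated by the differentials, is homotopy equivalent to its homology. -/
noncomputable def homotopyEquivHomologyComplexOfHomotopy (h : Homotopy p (𝟙 K)) :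
    HomotopyEquiv K K.homologyComplex where
  hom := toHomologyComplex p hp
  inv := fromHomologyComplex p hp
  homotopyHomInvId := (Homotopy.ofEq (toHomologyComplex_comp_from p hp)).trans
    ((h.comp h).trans (Homotopy.ofEq (Category.comp_id _)))
  homotopyInvHomId := Homotopy.ofEq (fromHomologyComplex_comp_to p hp h)

variable (K) in
/-- In a category where every morphism is von Neumann regular,
a complex is homotopy equivalent to its homology. -/
lemma nonempty_homotopyEquiv_homologyComplex
    (H : ∀ ⦃X Y : V⦄ (f : X ⟶ Y), ∃ g : Y ⟶ X, f ≫ g ≫ f = f) :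
    Nonempty (HomotopyEquiv K K.homologyComplex) := by
  choose g hg using H
  let s : ∀ i j, c.Rel j i → (K.X i ⟶ K.X j) := fun i j _ => g (K.d j i)
  let p : K ⟶ K := 𝟙 K - Homotopy.nullHomotopicMap' s
  have hp : ∀ i j, p.f i ≫ K.d i j = 0 := fun i j => by
    by_cases hij : c.Rel i j
    · obtain rfl := c.next_eq' hij
      simp [p, s, Homotopy.nullHomotopicMap', Homotopy.nullHomotopicMap, hij,
        Preadditive.sub_comp, dNext, prevD, hg]
    · simp [K.shape _ _ hij]
  exact ⟨homotopyEquivHomologyComplexOfHomotopy p hp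
    (Homotopy.equivSubZero.symm ((Homotopy.ofEq (sub_sub_cancel _ _)).trans
      (Homotopy.nullHomotopy' s))).symm⟩

end regular

end HomologicalComplex

lemma ModuleCat.exists_regular {k : Type*} [Field k] ⦃X Y : ModuleCat k⦄ (f : X ⟶ Y) :
    ∃ g : Y ⟶ X, f ≫ g ≫ f = f := by
  obtain ⟨s, hs⟩ := f.hom.rangeRestrict.exists_rightInverse_of_surjective
    f.hom.range_rangeRestrict
  obtain ⟨g, hg⟩ := s.exists_extend
  refine ⟨ofHom g, ?_⟩
  ext x
  have h₁ : g (f x) = s (f.hom.rangeRestrict x) := LinearMap.congr_fun hg (f.hom.rangeRestrict x)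
  have h₂ := congr_arg Subtype.val (LinearMap.congr_fun hs (f.hom.rangeRestrict x))
  simpa [h₁] using h₂

namespace HomologicalComplex

section

variable {C₁ C₂ D : Type*} [Category* C₁] [Category* C₂] [Category* D]
  [Preadditive C₁] [Preadditive C₂] [Preadditive D]
  {I₁ I₂ J : Type*} {c₁ : ComplexShape I₁} {c₂ : ComplexShape I₂}
  (F : C₁ ⥤ C₂ ⥤ D) [F.PreservesZeroMorphisms] [∀ X, (F.obj X).PreservesZeroMorphisms]
  (c : ComplexShape J) [TotalComplexShape c₁ c₂ c] [DecidableEq J]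

lemma mapBifunctor_d_eq_zero (K : HomologicalComplex C₁ c₁) (L : HomologicalComplex C₂ c₂)
    [HasMapBifunctor K L F c] (hK : ∀ i j, K.d i j = 0) (hL : ∀ i j, L.d i j = 0) (n m : J) :
    (mapBifunctor K L F c).d n m = 0 := by
  ext i j h
  simp only [mapBifunctor.d_eq, Preadditive.comp_add, mapBifunctor.ι_D₁, mapBifunctor.ι_D₂,
    comp_zero]
  have h₁ : mapBifunctor.d₁ K L F c i j m = 0 := by
    by_cases hi : c₁.Rel i (c₁.next i)
    · by_cases hm : ComplexShape.π c₁ c₂ c (c₁.next i, j) = m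
      · rw [mapBifunctor.d₁_eq _ _ _ _ hi _ _ hm, hK]
        simp
      · exact mapBifunctor.d₁_eq_zero' _ _ _ _ hi _ _ hm
    · exact mapBifunctor.d₁_eq_zero _ _ _ _ _ _ _ hi
  have h₂ : mapBifunctor.d₂ K L F c i j m = 0 := by
    by_cases hi : c₂.Rel j (c₂.next j)
    · by_cases hm : ComplexShape.π c₁ c₂ c (i, c₂.next j) = m
      · rw [mapBifunctor.d₂_eq _ _ _ _ _ hi _ hm, hL]
        simp
      · exact mapBifunctor.d₂_eq_zero' _ _ _ _ _ hi _ hm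
    · exact mapBifunctor.d₂_eq_zero _ _ _ _ _ _ _ hi
  rw [h₁, h₂, add_zero]

instance [HasCoproducts.{0} D] {I₁ I₂ J : Type} {c₁ : ComplexShape I₁} {c₂ : ComplexShape I₂}
    {c : ComplexShape J} [TotalComplexShape c₁ c₂ c]
    (K : HomologicalComplex C₁ c₁) (L : HomologicalComplex C₂ c₂) :
    HasMapBifunctor K L F c :=
  fun _ => inferInstance

/-- The homology of a complex with zero differentials. -/
noncomputable def homologyIsoXOfDEqZero (K : HomologicalComplex D c) (hK : ∀ i j, K.d i j = 0)
    (i : J) [K.HasHomology i] : K.homology i ≅ K.X i :=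
  haveI := K.isIso_homologyπ _ i rfl (hK _ _)
  haveI := K.isIso_iCycles i _ rfl (hK _ _)
  (asIso (K.homologyπ i)).symm ≪≫ asIso (K.iCycles i)

end

end HomologicalComplex

/-- The Künneth formula for chain complexes of vector spaces over a field. -/
lemma ChainComplex.nonempty_homology_tensor_iso_directSum {k : Type} [Field k]
    (K L : ChainComplex (ModuleCat.{0} k) ℕ) (n : ℕ) :
    Nonempty ((mapBifunctor K L (curriedTensor (ModuleCat.{0} k)) (ComplexShape.down ℕ)).homology n
      ≅ ModuleCat.of k (⨁ p : {p : ℕ × ℕ // p.1 + p.2 = n},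
        K.homology p.1.1 ⊗[k] L.homology p.1.2)) := by
  obtain ⟨e⟩ := K.nonempty_homotopyEquiv_homologyComplex ModuleCat.exists_regular
  obtain ⟨e'⟩ := L.nonempty_homotopyEquiv_homologyComplex ModuleCat.exists_regular
  refine ⟨(mapBifunctorHomotopyEquiv (curriedTensor (ModuleCat.{0} k)) (ComplexShape.down ℕ) e
      e').toHomologyIso n ≪≫
    homologyIsoXOfDEqZero _ _ (mapBifunctor_d_eq_zero _ _ _ _ (fun _ _ => rfl) fun _ _ => rfl) n ≪≫
    ?_⟩
  refine (isColimitMapBifunctorCofan (curriedTensor (ModuleCat.{0} k)) (ComplexShape.down ℕ)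
    K.homologyComplex L.homologyComplex n).coconePointUniqueUpToIso
    (ModuleCat.coproductCoconeIsColimit fun p : {p : ℕ × ℕ // p.1 + p.2 = n} =>
      ModuleCat.of k (K.homology p.1.1 ⊗[k] L.homology p.1.2))

namespace ModuleCat

section

variable {R S : Type} [CommRing R] [CommRing S] (f : R →+* S)

/-- The canonical map `m ↦ 1 ⊗ m` to the extension of scalars. -/
noncomputable def toExtendScalars (M : ModuleCat.{0} R) : M →+ (extendScalars f).obj M :=
  ((extendRestrictScalarsAdj f).unit.app M).hom.toAddMonoidHom

lemma toExtendScalars_smul (M : ModuleCat.{0} R) (r : R) (m : M) :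
    toExtendScalars f M (r • m) = f r • toExtendScalars f M m :=
  ((extendRestrictScalarsAdj f).unit.app M).hom.map_smul r m

variable {f} in
lemma extendScalars_linearMap_ext {M : ModuleCat.{0} R} {P : Type} [AddCommGroup P] [Module S P]
    {g g' : (extendScalars f).obj M →ₗ[S] P}
    (h : ∀ m, g (toExtendScalars f M m) = g' (toExtendScalars f M m)) : g = g' := by
  have : ofHom (Y := P) g = ofHom g' := by
    apply ((extendRestrictScalarsAdj f).homEquiv _ _).injective
    ext m
    exact h m
  exact congr_arg Hom.hom this

/-- The universal property of the extension of scalars. -/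
noncomputable def extendScalarsLift {M : ModuleCat.{0} R} {P : Type} [AddCommGroup P] [Module S P]
    (g : M →+ P) (hg : ∀ r m, g (r • m) = f r • g m) : (extendScalars f).obj M →ₗ[S] P :=
  (((extendRestrictScalarsAdj f).homEquiv M (of S P)).symm
    (ofHom (Y := (restrictScalars f).obj (of S P)) { g with map_smul' := hg })).hom

lemma extendScalarsLift_toExtendScalars {M : ModuleCat.{0} R} {P : Type} [AddCommGroup P]
    [Module S P] (g : M →+ P) (hg : ∀ r m, g (r • m) = f r • g m) (m : M) :
    extendScalarsLift f g hg (toExtendScalars f M m) = g m := by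
  have := ((extendRestrictScalarsAdj f).homEquiv M (of S P)).apply_symm_apply
    (ofHom (Y := (restrictScalars f).obj (of S P)) { g with map_smul' := hg })
  exact ConcreteCategory.congr_hom this m

end

section

variable {k A B : Type} [Field k] [CommRing A] [CommRing B] [Algebra k A] [Algebra k B]

variable (k A B) in
/-- The external tensor product of an `A`-module and a `B`-module, as a bifunctor to modules
over `A ⊗[k] B`. -/
noncomputable def externalTensor :
    ModuleCat.{0} A ⥤ ModuleCat.{0} B ⥤ ModuleCat.{0} (A ⊗[k] B) :=
  extendScalars (Algebra.TensorProduct.includeLeftRingHom (R := k) (A := A) (B := B)) ⋙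
    curriedTensor _ ⋙ (Functor.whiskeringLeft _ _ _).obj
      (extendScalars (Algebra.TensorProduct.includeRight (R := k) (A := A) (B := B)).toRingHom)

variable (M : ModuleCat.{0} A) (N : ModuleCat.{0} B)

variable (k) in
/-- The pure tensors in the external tensor product. -/
noncomputable def etmul : M →+ N →+ (((externalTensor k A B).obj M).obj N) :=
  AddMonoidHom.mk' (fun m => AddMonoidHom.mk' (fun n =>
      (show (((externalTensor k A B).obj M).obj N) from
        toExtendScalars (Algebra.TensorProduct.includeLeftRingHom (R := k) (A := A) (B := B)) M m
        ⊗ₜ[A ⊗[k] B] toExtendScalars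
          (Algebra.TensorProduct.includeRight (R := k) (A := A) (B := B)).toRingHom N n))
    (fun n n' => by rw [map_add]; exact TensorProduct.tmul_add _ _ _))
    (fun m m' => by ext n; simp only [map_add]; exact TensorProduct.add_tmul _ _ _)

variable {M N}

lemma tmul_smul_tmul_includeLeft_includeRight {U V : Type} [AddCommGroup U] [AddCommGroup V]
    [Module (A ⊗[k] B) U] [Module (A ⊗[k] B) V] (a : A) (b : B) (u : U) (v : V) :
    (a ⊗ₜ[k] b) • (u ⊗ₜ[A ⊗[k] B] v) =
      (Algebra.TensorProduct.includeLeftRingHom (R := k) (A := A) (B := B) a • u) ⊗ₜ[A ⊗[k] B]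
        ((Algebra.TensorProduct.includeRight (R := k) (A := A) (B := B)).toRingHom b • v) := by
  rw [TensorProduct.tmul_smul, ← TensorProduct.smul_tmul', smul_smul]
  simp

lemma tmul_smul_etmul (a : A) (b : B) (m : M) (n : N) :
    (a ⊗ₜ[k] b) • etmul k M N m n = etmul k M N (a • m) (b • n) := by
  have h := tmul_smul_tmul_includeLeft_includeRight (k := k) a b
    (toExtendScalars (Algebra.TensorProduct.includeLeftRingHom (R := k) (A := A) (B := B)) M m)
    (toExtendScalars (Algebra.TensorProduct.includeRight (R := k) (A := A) (B := B)).toRingHom N n)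
  rw [← toExtendScalars_smul, ← toExtendScalars_smul] at h
  exact h

/-- Linear maps from the external tensor product are determined by their values on
pure tensors. -/
lemma externalTensor_linearMap_ext {P : Type} [AddCommGroup P] [Module (A ⊗[k] B) P]
    {g g' : ((externalTensor k A B).obj M).obj N →ₗ[A ⊗[k] B] P}
    (h : ∀ m n, g (etmul k M N m n) = g' (etmul k M N m n)) : g = g' :=
  TensorProduct.ext (extendScalars_linearMap_ext fun m =>
    extendScalars_linearMap_ext fun n => h m n)

lemma externalTensor_hom_ext {P : ModuleCat.{0} (A ⊗[k] B)}
    {g g' : ((externalTensor k A B).obj M).obj N ⟶ P}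
    (h : ∀ m n, g (etmul k M N m n) = g' (etmul k M N m n)) : g = g' :=
  hom_ext (externalTensor_linearMap_ext h)

end

section

variable {k A B M N : Type} [Field k] [CommRing A] [CommRing B] [Algebra k A] [Algebra k B]
    [AddCommGroup M] [Module k M] [Module A M] [IsScalarTower k A M]
    [AddCommGroup N] [Module B N]

lemma etmul_smul_left (r : k) (m : M) (n : N) :
    etmul k (of A M) (of B N) (r • m) n =
      algebraMap k (A ⊗[k] B) r • etmul k (of A M) (of B N) m n := by
  have := tmul_smul_etmul (k := k) (M := of A M) (N := of B N) (algebraMap k A r) 1 m n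
  rw [one_smul] at this
  rw [← algebraMap_smul A r m]
  exact this.symm

end

section

variable {k A B M N : Type} [Field k] [CommRing A] [CommRing B] [Algebra k A] [Algebra k B]
    [AddCommGroup M] [Module A M]
    [AddCommGroup N] [Module k N] [Module B N] [IsScalarTower k B N]

lemma etmul_smul_right (r : k) (m : M) (n : N) :
    etmul k (of A M) (of B N) m (r • n) =
      algebraMap k (A ⊗[k] B) r • etmul k (of A M) (of B N) m n := by
  have := tmul_smul_etmul (k := k) (M := of A M) (N := of B N) 1 (algebraMap k B r) m n
  have h : (1 : A) ⊗ₜ[k] algebraMap k B r = algebraMap k (A ⊗[k] B) r :=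
    (Algebra.TensorProduct.includeRight (R := k) (A := A) (B := B)).commutes r
  rw [one_smul, h] at this
  rw [← algebraMap_smul B r n]
  exact this.symm

end

section

variable {k A B M N : Type} [Field k] [CommRing A] [CommRing B] [Algebra k A] [Algebra k B]
    [AddCommGroup M] [Module k M] [Module A M]
    [AddCommGroup N] [Module k N] [Module B N]

section

variable [IsScalarTower k A M] [IsScalarTower k B N]

/-- The canonical map from the tensor product over `k` to the external tensor product. -/
noncomputable def toExternalTensor :
    M ⊗[k] N →+ ((externalTensor k A B).obj (of A M)).obj (of B N) :=
  TensorProduct.liftAddHom (etmul k (of A M) (of B N)) fun r m n =>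
    (etmul_smul_left r m n).trans (etmul_smul_right r m n).symm

end

variable [Module (A ⊗[k] B) (M ⊗[k] N)]
    (h : ∀ (a : A) (b : B) (m : M) (x : N),
      (a ⊗ₜ[k] b) • (m ⊗ₜ[k] x) = (a • m) ⊗ₜ[k] (b • x))

/-- The map from the extension of scalars of `N` to `M ⊗[k] N` induced by an element of `M`. -/
noncomputable def ofExternalTensorAux (m : M) :
    (extendScalars (Algebra.TensorProduct.includeRight (R := k) (A := A) (B := B)).toRingHom).obj
      (of B N) →ₗ[A ⊗[k] B] M ⊗[k] N :=
  extendScalarsLift (M := of B N) _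
    (TensorProduct.mk k M N m).toAddMonoidHom
    (fun b (n : N) => ((h 1 b m n).trans (congr_arg (· ⊗ₜ[k] (b • n)) (one_smul A m))).symm)

lemma ofExternalTensorAux_apply (m : M) (n : N) :
    ofExternalTensorAux h m (toExtendScalars _ (of B N) n) = m ⊗ₜ n :=
  extendScalarsLift_toExtendScalars (M := of B N) _ _ _ n

/-- The curried form of `ofExternalTensor`. -/
noncomputable def ofExternalTensorCurried :
    (extendScalars (Algebra.TensorProduct.includeLeftRingHom (R := k) (A := A) (B := B))).obj
      (of A M) →ₗ[A ⊗[k] B]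
    (extendScalars (Algebra.TensorProduct.includeRight (R := k) (A := A) (B := B)).toRingHom).obj
      (of B N) →ₗ[A ⊗[k] B] M ⊗[k] N :=
  extendScalarsLift (M := of A M) _
    (AddMonoidHom.mk' (fun m : M => ofExternalTensorAux h m)
      fun m m' => extendScalars_linearMap_ext fun (n : N) => by
        rw [LinearMap.add_apply, ofExternalTensorAux_apply, ofExternalTensorAux_apply,
          ofExternalTensorAux_apply, TensorProduct.add_tmul])
    fun a (m : M) => extendScalars_linearMap_ext fun (n : N) => by
      have h₁ : ofExternalTensorAux h (a • m) (toExtendScalars _ (of B N) n) =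
          (a ⊗ₜ[k] (1 : B)) • ofExternalTensorAux h m (toExtendScalars _ (of B N) n) := by
        rw [ofExternalTensorAux_apply, ofExternalTensorAux_apply, h, one_smul]
      exact h₁

/-- The canonical map from the external tensor product to the tensor product over `k`. -/
noncomputable def ofExternalTensor :
    ((externalTensor k A B).obj (of A M)).obj (of B N) →ₗ[A ⊗[k] B] M ⊗[k] N :=
  TensorProduct.lift (ofExternalTensorCurried h)

lemma ofExternalTensor_etmul (m : M) (n : N) :
    ofExternalTensor h (etmul k (of A M) (of B N) m n) = m ⊗ₜ n := by
  have h₁ : ofExternalTensorCurried h (toExtendScalars _ (of A M) m) = ofExternalTensorAux h m :=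
    extendScalarsLift_toExtendScalars (M := of A M) _ _ _ m
  have h₂ : ofExternalTensorCurried h (toExtendScalars _ (of A M) m)
      (toExtendScalars _ (of B N) n) = m ⊗ₜ n := by
    rw [h₁, ofExternalTensorAux_apply]
  exact h₂

variable [IsScalarTower k A M] [IsScalarTower k B N]

lemma toExternalTensor_smul (h : ∀ (a : A) (b : B) (m : M) (x : N),
      (a ⊗ₜ[k] b) • (m ⊗ₜ[k] x) = (a • m) ⊗ₜ[k] (b • x)) (r : A ⊗[k] B) (x : M ⊗[k] N) :
    toExternalTensor (r • x) = r • toExternalTensor (A := A) (B := B) x := by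
  induction r with
  | zero => rw [zero_smul, zero_smul, map_zero]
  | add r s hr hs => rw [add_smul, map_add, hr, hs, add_smul]
  | tmul a b =>
    induction x with
    | zero => rw [smul_zero, map_zero, smul_zero]
    | add x y hx hy => rw [smul_add, map_add, map_add, hx, hy, smul_add]
    | tmul m n =>
      rw [h]
      exact (tmul_smul_etmul (k := k) (M := of A M) (N := of B N) a b m n).symm

/-- The external tensor product is the tensor product over `k`,
equipped with its natural action of `A ⊗[k] B`. -/
noncomputable def externalTensorEquiv :
    M ⊗[k] N ≃ₗ[A ⊗[k] B] ((externalTensor k A B).obj (of A M)).obj (of B N) :=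
  LinearEquiv.ofLinearMap
    { toExternalTensor with
      map_smul' := toExternalTensor_smul h }
    (ofExternalTensor h)
    (externalTensor_linearMap_ext fun m n => by
      exact congr_arg toExternalTensor (ofExternalTensor_etmul h m n))
    (LinearMap.ext fun x => by
      induction x with
      | zero => rw [map_zero, map_zero]
      | add x y hx hy => rw [map_add, map_add, hx, hy]
      | tmul m n => exact ofExternalTensor_etmul h m n)

end

end ModuleCat

namespace ModuleCat

section

variable (k A B M N : Type) [Field k] [CommRing A] [CommRing B] [Algebra k A] [Algebra k B]
    [AddCommGroup M] [Module k M] [Module A M] [IsScalarTower k A M]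
    [AddCommGroup N] [Module k N] [Module B N] [IsScalarTower k B N]

/-- The natural action of `A ⊗[k] B` on `M ⊗[k] N`. -/
noncomputable abbrev tensorProductModule : Module (A ⊗[k] B) (M ⊗[k] N) :=
  Module.compHom _ ((Module.endTensorEndAlgHom (R := k) (S := k) (A := k) (M := M) (N := N)).comp
    (Algebra.TensorProduct.map (Algebra.lsmul k k M : A →ₐ[k] _)
      (Algebra.lsmul k k N : B →ₐ[k] _))).toRingHom

variable {k A B M N}

lemma bijective_toExternalTensor :
    Function.Bijective (toExternalTensor (k := k) (A := A) (B := B) (M := M) (N := N)) :=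
  letI := tensorProductModule k A B M N
  (externalTensorEquiv (k := k) (A := A) (B := B) (M := M) (N := N) fun _ _ _ _ => rfl).bijective

lemma toExternalTensor_smul_base (r : k) (x : M ⊗[k] N) :
    toExternalTensor (A := A) (B := B) (r • x) =
      algebraMap k (A ⊗[k] B) r • toExternalTensor (A := A) (B := B) x := by
  induction x with
  | zero => rw [smul_zero, map_zero, smul_zero]
  | add x y hx hy => rw [smul_add, map_add, map_add, hx, hy, smul_add]
  | tmul m n => exact etmul_smul_left (k := k) (A := A) (B := B) r m n

end

section

variable {k A B : Type} [Field k] [CommRing A] [CommRing B] [Algebra k A] [Algebra k B]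

/-- Restricting scalars to `k` turns the external tensor product into the tensor product
over `k`. -/
noncomputable def restrictExternalTensorIso (M : ModuleCat.{0} A) (N : ModuleCat.{0} B) :
    (restrictScalars (algebraMap k A)).obj M ⊗ (restrictScalars (algebraMap k B)).obj N ≅
      (restrictScalars (algebraMap k (A ⊗[k] B))).obj (((externalTensor k A B).obj M).obj N) :=
  letI : Module k M := Module.compHom M (algebraMap k A)
  letI : Module k N := Module.compHom N (algebraMap k B)
  haveI : IsScalarTower k A M := .of_algebraMap_smul fun _ _ => rfl
  haveI : IsScalarTower k B N := .of_algebraMap_smul fun _ _ => rfl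
  let f : M ⊗[k] N →ₗ[k]
      (restrictScalars (algebraMap k (A ⊗[k] B))).obj (((externalTensor k A B).obj M).obj N) :=
    { toFun := toExternalTensor (k := k) (A := A) (B := B) (M := M) (N := N)
      map_add' := map_add toExternalTensor
      map_smul' := toExternalTensor_smul_base }
  (LinearEquiv.ofBijective f bijective_toExternalTensor).toModuleIso

variable {M M' : ModuleCat.{0} A} {N N' : ModuleCat.{0} B}

lemma restrictExternalTensorIso_naturality_left (f : M ⟶ M') (N : ModuleCat.{0} B) :
    (restrictScalars (algebraMap k A)).map f ▷ _ ≫ (restrictExternalTensorIso (k := k) M' N).hom =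
      (restrictExternalTensorIso (k := k) M N).hom ≫
        (restrictScalars (algebraMap k (A ⊗[k] B))).map (((externalTensor k A B).map f).app N) :=
  ModuleCat.MonoidalCategory.tensor_ext fun _ _ => rfl

lemma restrictExternalTensorIso_naturality_right (M : ModuleCat.{0} A) (f : N ⟶ N') :
    _ ◁ (restrictScalars (algebraMap k B)).map f ≫ (restrictExternalTensorIso (k := k) M N').hom =
      (restrictExternalTensorIso (k := k) M N).hom ≫
        (restrictScalars (algebraMap k (A ⊗[k] B))).map (((externalTensor k A B).obj M).map f) :=
  ModuleCat.MonoidalCategory.tensor_ext fun _ _ => rfl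

end

end ModuleCat

namespace CategoryTheory.Functor

section

variable {C₁ C₂ D : Type*} [Category* C₁] [Category* C₂] [Category* D] [MonoidalCategory C₁]
  [MonoidalCategory C₂] [MonoidalCategory D] [BraidedCategory D] (a : C₁ ⥤ D) (b : C₂ ⥤ D)
  [a.Monoidal] [b.Monoidal]

/-- The interchange isomorphism for the tensor product of two monoidal functors. -/
noncomputable def tensorInterchangeIso (X X' : C₁) (Y Y' : C₂) :
    (a.obj X ⊗ b.obj Y) ⊗ (a.obj X' ⊗ b.obj Y') ≅ a.obj (X ⊗ X') ⊗ b.obj (Y ⊗ Y') :=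
  { hom := tensorμ _ _ _ _
    inv := tensorδ _ _ _ _
    hom_inv_id := tensorμ_tensorδ _ _ _ _
    inv_hom_id := tensorδ_tensorμ _ _ _ _ } ≪≫
    (Monoidal.μIso a X X' ⊗ᵢ Monoidal.μIso b Y Y')

lemma tensorInterchangeIso_naturality_left (X : C₁) {X' X'' : C₁} (f : X' ⟶ X'') (Y Y' : C₂) :
    (a.obj X ⊗ b.obj Y) ◁ (a.map f ▷ b.obj Y') ≫ (tensorInterchangeIso a b X X'' Y Y').hom =
      (tensorInterchangeIso a b X X' Y Y').hom ≫ a.map (X ◁ f) ▷ b.obj (Y ⊗ Y') := by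
  have := tensorμ_natural_right (a.obj X) (b.obj Y) (a.map f) (𝟙 (b.obj Y'))
  rw [tensorHom_id, MonoidalCategory.whiskerLeft_id, tensorHom_id] at this
  change _ ≫ tensorμ _ _ _ _ ≫ (LaxMonoidal.μ a _ _ ⊗ₘ LaxMonoidal.μ b _ _) =
    (tensorμ _ _ _ _ ≫ (LaxMonoidal.μ a _ _ ⊗ₘ LaxMonoidal.μ b _ _)) ≫ _
  rw [reassoc_of% this, Category.assoc, MonoidalCategory.tensorHom_def, ← comp_whiskerRight_assoc,
    LaxMonoidal.μ_natural_right, comp_whiskerRight_assoc, ← whisker_exchange,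
    MonoidalCategory.tensorHom_def, Category.assoc]

lemma tensorInterchangeIso_naturality_right (X X' : C₁) (Y : C₂) {Y' Y'' : C₂} (f : Y' ⟶ Y'') :
    (a.obj X ⊗ b.obj Y) ◁ (a.obj X' ◁ b.map f) ≫ (tensorInterchangeIso a b X X' Y Y'').hom =
      (tensorInterchangeIso a b X X' Y Y').hom ≫ a.obj (X ⊗ X') ◁ b.map (Y ◁ f) := by
  have := tensorμ_natural_right (a.obj X) (b.obj Y) (𝟙 (a.obj X')) (b.map f)
  rw [id_tensorHom, MonoidalCategory.whiskerLeft_id, id_tensorHom] at this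
  change _ ≫ tensorμ _ _ _ _ ≫ (LaxMonoidal.μ a _ _ ⊗ₘ LaxMonoidal.μ b _ _) =
    (tensorμ _ _ _ _ ≫ (LaxMonoidal.μ a _ _ ⊗ₘ LaxMonoidal.μ b _ _)) ≫ _
  rw [reassoc_of% this, Category.assoc, MonoidalCategory.tensorHom_def',
    ← MonoidalCategory.whiskerLeft_comp_assoc,
    LaxMonoidal.μ_natural_right, MonoidalCategory.whiskerLeft_comp_assoc, whisker_exchange,
    MonoidalCategory.tensorHom_def', Category.assoc]

end

end CategoryTheory.Functor

namespace ModuleCat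

variable {k A B : Type} [Field k] [CommRing A] [CommRing B] [Algebra k A] [Algebra k B]

/-- The external tensor product is compatible with tensor products. -/
noncomputable def externalTensorInterchangeIso (M M' : ModuleCat.{0} A) (N N' : ModuleCat.{0} B) :
    ((externalTensor k A B).obj M).obj N ⊗ ((externalTensor k A B).obj M').obj N' ≅
      ((externalTensor k A B).obj (M ⊗ M')).obj (N ⊗ N') :=
  Functor.tensorInterchangeIso _ _ M M' N N'

lemma externalTensorInterchangeIso_naturality_left (M : ModuleCat.{0} A) {M' M'' : ModuleCat.{0} A}
    (f : M' ⟶ M'') (N N' : ModuleCat.{0} B) :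
    ((externalTensor k A B).obj M).obj N ◁ ((externalTensor k A B).map f).app N' ≫
      (externalTensorInterchangeIso M M'' N N').hom =
    (externalTensorInterchangeIso M M' N N').hom ≫
      ((externalTensor k A B).map (M ◁ f)).app (N ⊗ N') :=
  Functor.tensorInterchangeIso_naturality_left _ _ M f N N'

lemma externalTensorInterchangeIso_naturality_right (M M' : ModuleCat.{0} A) (N : ModuleCat.{0} B)
    {N' N'' : ModuleCat.{0} B} (f : N' ⟶ N'') :
    ((externalTensor k A B).obj M).obj N ◁ ((externalTensor k A B).obj M').map f ≫
      (externalTensorInterchangeIso M M' N N'').hom =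
    (externalTensorInterchangeIso M M' N N').hom ≫
      ((externalTensor k A B).obj (M ⊗ M')).map (N ◁ f) :=
  Functor.tensorInterchangeIso_naturality_right _ _ M M' N f

end ModuleCat

namespace ModuleCat

instance {R S : Type} [CommRing R] [CommRing S] (f : R →+* S) :
    (extendScalars.{0} f).Additive :=
  (extendRestrictScalarsAdj f).left_adjoint_additive

instance {R S : Type} [CommRing R] [CommRing S] (f : R →+* S) :
    (extendScalars.{0} f).PreservesProjectiveObjects :=
  Functor.preservesProjectiveObjects_of_adjunction_of_preservesEpimorphisms
    (extendRestrictScalarsAdj f)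

instance projective_of_field {k : Type} [Field k] (M : ModuleCat.{0} k) : Projective M :=
  (IsProjective.iff_projective M).1 (.of_basis (Module.Basis.ofVectorSpace k M))

instance {R k : Type} [CommRing R] [Field k] (f : k →+* R) :
    (restrictScalars.{0} f).PreservesProjectiveObjects where
  projective_obj _ := inferInstance

instance {R : Type} [CommRing R] (M N : ModuleCat.{0} R) [Projective M] [Projective N] :
    Projective (M ⊗ N) := by
  have := (IsProjective.iff_projective (R := R) M).2 ‹_›
  have := (IsProjective.iff_projective (R := R) N).2 ‹_›
  exact (IsProjective.iff_projective (R := R) (M ⊗[R] N)).1 inferInstance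

variable {k A B : Type} [Field k] [CommRing A] [CommRing B] [Algebra k A] [Algebra k B]

instance (M : ModuleCat.{0} A) : ((externalTensor k A B).obj M).Additive :=
  inferInstanceAs (extendScalars _ ⋙ (curriedTensor _).obj _).Additive

instance : (externalTensor k A B).Additive where
  map_add {M M' f g} := by
    ext1
    ext1 N
    exact externalTensor_hom_ext fun m n =>
      (congr_arg (fun h => h n) (map_add (etmul k M' N) (f m) (g m)))

instance (M : ModuleCat.{0} A) (N : ModuleCat.{0} B) [Projective M] [Projective N] :
    Projective (((externalTensor k A B).obj M).obj N) :=
  inferInstanceAs (Projective (MonoidalCategory.tensorObj ((extendScalars _).obj M)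
    ((extendScalars _).obj N)))

end ModuleCat

namespace HomologicalComplex

variable {C₁ C₂ D : Type*} [Category* C₁] [Category* C₂] [Category* D]
  [Preadditive C₁] [Preadditive C₂] [Preadditive D]
  (F : C₁ ⥤ C₂ ⥤ D) [F.PreservesZeroMorphisms] [∀ X, (F.obj X).PreservesZeroMorphisms]

lemma projective_mapBifunctor_X {I₁ I₂ J : Type*} {c₁ : ComplexShape I₁} {c₂ : ComplexShape I₂}
    (c : ComplexShape J) [TotalComplexShape c₁ c₂ c] [DecidableEq J]
    (K : HomologicalComplex C₁ c₁) (L : HomologicalComplex C₂ c₂) [HasMapBifunctor K L F c]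
    (h : ∀ i j, Projective ((F.obj (K.X i)).obj (L.X j))) (n : J) :
    Projective ((mapBifunctor K L F c).X n) where
  factors f e _ :=
    ⟨mapBifunctorDesc fun i j hij =>
      Projective.factorThru (ιMapBifunctor K L F c i j n hij ≫ f) e, by
      ext i j hij
      simp⟩

variable [HasZeroObject C₁] [HasZeroObject C₂] [HasZeroObject D] [HasCoproducts.{0} D]
  (X : C₁) (Y : C₂)

lemma isZero_mapBifunctor_single₀_X (n : ℕ) (hn : n ≠ 0) :
    IsZero ((mapBifunctor ((ChainComplex.single₀ C₁).obj X) ((ChainComplex.single₀ C₂).obj Y) F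
      (ComplexShape.down ℕ)).X n) := by
  rw [IsZero.iff_id_eq_zero]
  ext i j h
  apply IsZero.eq_of_src
  by_cases hi : i = 0
  · have hj : j ≠ 0 := by
      rintro rfl
      exact hn (by subst hi; exact h.symm)
    exact Functor.map_isZero _ (isZero_single_obj_X _ _ _ _ hj)
  · exact (F.map_isZero (isZero_single_obj_X _ _ _ _ hi)).obj _

/-- The total complex of two complexes concentrated in degree zero,
in degree zero. -/
noncomputable def mapBifunctorSingle₀XZeroIso :
    (mapBifunctor ((ChainComplex.single₀ C₁).obj X) ((ChainComplex.single₀ C₂).obj Y) F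
      (ComplexShape.down ℕ)).X 0 ≅ (F.obj X).obj Y := by
  let K := (ChainComplex.single₀ C₁).obj X
  let L := (ChainComplex.single₀ C₂).obj Y
  have key : ∀ i j : ℕ, i + j = 0 → i = 0 ∧ j = 0 := fun _ _ => Nat.add_eq_zero_iff.1
  exact
    { hom := mapBifunctorDesc (K₁ := K) (K₂ := L) (F := F) (c := ComplexShape.down ℕ) fun i j h =>
        eqToHom (by obtain ⟨rfl, rfl⟩ := key i j h; rfl)
      inv := ιMapBifunctor K L F (ComplexShape.down ℕ) 0 0 0 rfl
      hom_inv_id := by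
        ext i j h
        obtain ⟨rfl, rfl⟩ := key i j h
        exact (ι_mapBifunctorDesc_assoc ..).trans
          ((Category.id_comp _).trans (Category.comp_id _).symm)
      inv_hom_id := by
        exact (ι_mapBifunctorDesc ..) }

/-- The total complex of two complexes concentrated in degree zero. -/
noncomputable def mapBifunctorSingle₀Iso :
    mapBifunctor ((ChainComplex.single₀ C₁).obj X) ((ChainComplex.single₀ C₂).obj Y) F
      (ComplexShape.down ℕ) ≅ (ChainComplex.single₀ D).obj ((F.obj X).obj Y) :=
  Hom.isoOfComponents
    (fun n => match n with
      | 0 => mapBifunctorSingle₀XZeroIso F X Y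
      | n + 1 => (isZero_mapBifunctor_single₀_X F X Y (n + 1) (by omega)).iso
          (isZero_single_obj_X _ _ _ _ (by omega)))
    fun i j h => (isZero_mapBifunctor_single₀_X F X Y i
      (by have : j + 1 = i := h; omega)).eq_of_src _ _

end HomologicalComplex

namespace CategoryTheory.ProjectiveResolution

variable {k R : Type} [Field k] [CommRing R] [Algebra k R] {M : ModuleCat.{0} R}
  (P : ProjectiveResolution M)

/-- A projective resolution becomes a homotopy equivalence after restriction of scalars
to a field. -/
lemma exists_homotopyEquiv_restrictScalars :
    ∃ e : HomotopyEquiv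
        (((ModuleCat.restrictScalars.{0} (algebraMap k R)).mapHomologicalComplex _).obj P.complex)
        (((ModuleCat.restrictScalars.{0} (algebraMap k R)).mapHomologicalComplex _).obj
          ((ChainComplex.single₀ _).obj M)),
      e.hom =
        ((ModuleCat.restrictScalars.{0} (algebraMap k R)).mapHomologicalComplex _).map P.π := by
  let G := ModuleCat.restrictScalars.{0} (algebraMap k R)
  let P' := G.mapProjectiveResolution P
  let e := (singleMapHomologicalComplex G (ComplexShape.down ℕ) 0).app M
  refine ⟨(homotopyEquiv P' (self _)).trans (HomotopyEquiv.ofIso e.symm), ?_⟩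
  have h : (homotopyEquiv P' (self (G.obj M))).hom =
      (G.mapHomologicalComplex _).map P.π ≫ e.hom :=
    (Category.comp_id _).symm.trans (homotopyEquiv_hom_π P' (self (G.obj M)))
  exact (congr_arg (· ≫ e.inv) h).trans ((Category.assoc _ _ _).trans
    ((congr_arg (_ ≫ ·) e.hom_inv_id).trans (Category.comp_id _)))

end CategoryTheory.ProjectiveResolution

namespace ModuleCat

variable {k A B : Type} [Field k] [CommRing A] [CommRing B] [Algebra k A] [Algebra k B]

section

variable (K K' : ChainComplex (ModuleCat.{0} A) ℕ) (L L' : ChainComplex (ModuleCat.{0} B) ℕ)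

/-- Restriction of scalars of the total external tensor product of complexes. -/
noncomputable def restrictMapBifunctorIso :
    mapBifunctor (((restrictScalars.{0} (algebraMap k A)).mapHomologicalComplex _).obj K)
      (((restrictScalars.{0} (algebraMap k B)).mapHomologicalComplex _).obj L)
      (curriedTensor (ModuleCat.{0} k)) (ComplexShape.down ℕ) ≅
    ((restrictScalars.{0} (algebraMap k (A ⊗[k] B))).mapHomologicalComplex _).obj
      (mapBifunctor K L (externalTensor k A B) (ComplexShape.down ℕ)) :=
  mapBifunctorComparison
    (K₁ := ((restrictScalars.{0} (algebraMap k A)).mapHomologicalComplex _).obj K)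
    (L₁ := ((restrictScalars.{0} (algebraMap k B)).mapHomologicalComplex _).obj L)
    (H := curriedTensor (ModuleCat.{0} k))
    (fun i j => restrictExternalTensorIso (K.X i) (L.X j))
    (fun i i' j => restrictExternalTensorIso_naturality_left (K.d i i') (L.X j))
    (fun i j j' => restrictExternalTensorIso_naturality_right (K.X i) (L.d j j'))

variable {K K' L L'}

lemma restrictMapBifunctorIso_naturality (f : K ⟶ K') (g : L ⟶ L') :
    mapBifunctorMap (((restrictScalars.{0} (algebraMap k A)).mapHomologicalComplex _).map f)
      (((restrictScalars.{0} (algebraMap k B)).mapHomologicalComplex _).map g)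
      (curriedTensor (ModuleCat.{0} k)) (ComplexShape.down ℕ) ≫
        (restrictMapBifunctorIso (k := k) K' L').hom =
    (restrictMapBifunctorIso (k := k) K L).hom ≫
      ((restrictScalars.{0} (algebraMap k (A ⊗[k] B))).mapHomologicalComplex _).map
        (mapBifunctorMap f g (externalTensor k A B) (ComplexShape.down ℕ)) := by
  ext1 n
  refine mapBifunctorMap_comp_comparisonF
    (K₁ := ((restrictScalars.{0} (algebraMap k A)).mapHomologicalComplex _).obj K)
    (L₁ := ((restrictScalars.{0} (algebraMap k B)).mapHomologicalComplex _).obj L)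
    (K₁' := ((restrictScalars.{0} (algebraMap k A)).mapHomologicalComplex _).obj K')
    (L₁' := ((restrictScalars.{0} (algebraMap k B)).mapHomologicalComplex _).obj L')
    (H := curriedTensor (ModuleCat.{0} k)) (F := externalTensor k A B)
    (fun i j => restrictExternalTensorIso (K.X i) (L.X j))
    (fun i j => restrictExternalTensorIso (K'.X i) (L'.X j)) f g _ _ (fun i j => ?_) n
  have h₁ := restrictExternalTensorIso_naturality_left (k := k) (f.f i) (L.X j)
  have h₂ := restrictExternalTensorIso_naturality_right (k := k) (K'.X i) (g.f j)
  exact (congr_arg (_ ≫ ·) h₂).trans ((Category.assoc _ _ _).symm.trans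
    ((congr_arg (· ≫ _) h₁).trans ((Category.assoc _ _ _).trans
      (congr_arg (_ ≫ ·) (Functor.map_comp _ _ _).symm))))

end

variable {M : ModuleCat.{0} A} {N : ModuleCat.{0} B}
  (P : ProjectiveResolution M) (Q : ProjectiveResolution N)

lemma quasiIso_mapBifunctorMap_π :
    QuasiIso (mapBifunctorMap P.π Q.π (externalTensor k A B) (ComplexShape.down ℕ)) := by
  rw [← quasiIso_map_iff_of_preservesHomology _ (restrictScalars.{0} (algebraMap k (A ⊗[k] B)))]
  obtain ⟨e, he⟩ := P.exists_homotopyEquiv_restrictScalars (k := k)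
  obtain ⟨e', he'⟩ := Q.exists_homotopyEquiv_restrictScalars (k := k)
  have h := restrictMapBifunctorIso_naturality (k := k) P.π Q.π
  have h' : QuasiIso (mapBifunctorMap e.hom e'.hom
      (curriedTensor (ModuleCat.{0} k)) (ComplexShape.down ℕ)) :=
    (mapBifunctorHomotopyEquiv (curriedTensor (ModuleCat.{0} k)) (ComplexShape.down ℕ) e
      e').quasiIso_hom
  rw [he, he'] at h'
  rw [← Iso.inv_comp_eq] at h
  rw [← h]
  infer_instance

variable (k) in
/-- The external tensor product of projective resolutions is a projective resolution. -/
noncomputable def externalTensorResolution :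
    ProjectiveResolution (((externalTensor k A B).obj M).obj N) where
  complex := mapBifunctor P.complex Q.complex (externalTensor k A B) (ComplexShape.down ℕ)
  projective := projective_mapBifunctor_X _ _ _ _ fun _ _ => inferInstance
  π := mapBifunctorMap P.π Q.π _ _ ≫ (mapBifunctorSingle₀Iso (externalTensor k A B) M N).hom
  quasiIso :=
    haveI := quasiIso_mapBifunctorMap_π (k := k) P Q
    inferInstance

end ModuleCat

lemma CategoryTheory.Functor.comp_trans_mapIso_symm_hom {C D : Type*} [Category* C] [Category* D]
    (G : C ⥤ D) {X X' : D} {Y Y' Z Z' : C} (e₁ : X ≅ G.obj Y) (e₁' : X' ≅ G.obj Y')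
    (e₂ : Z ≅ Y) (e₂' : Z' ≅ Y') {f : X ⟶ X'} {g : Y ⟶ Y'} {h : Z ⟶ Z'}
    (h₁ : f ≫ e₁'.hom = e₁.hom ≫ G.map g) (h₂ : h ≫ e₂'.hom = e₂.hom ≫ g) :
    f ≫ (e₁' ≪≫ G.mapIso e₂'.symm).hom = (e₁ ≪≫ G.mapIso e₂.symm).hom ≫ G.map h := by
  have h₃ : g ≫ e₂'.inv = e₂.inv ≫ h := by
    rw [Iso.eq_inv_comp, ← reassoc_of% h₂, e₂'.hom_inv_id, Category.comp_id]
  simp only [Iso.trans_hom, mapIso_hom, Iso.symm_hom, Category.assoc, reassoc_of% h₁,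
    ← G.map_comp, h₃]

namespace ModuleCat

section

variable (k : Type) {R : Type} [Field k] [CommRing R] [Algebra k R]

/-- The underlying complex over `k` of the tensor product of a module with a complex. -/
noncomputable abbrev restrictTensor (M : ModuleCat.{0} R) (K : ChainComplex (ModuleCat.{0} R) ℕ) :
    ChainComplex (ModuleCat.{0} k) ℕ :=
  ((restrictScalars.{0} (algebraMap k R)).mapHomologicalComplex _).obj
    ((((tensoringLeft (ModuleCat.{0} R)).obj M).mapHomologicalComplex _).obj K)

/-- Tor groups, regarded as `k`-vector spaces, are computed by projective resolutions. -/
noncomputable def restrictTorIso (M : ModuleCat.{0} R) {M' : ModuleCat.{0} R}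
    (P : ProjectiveResolution M') (n : ℕ) :
    (restrictScalars.{0} (algebraMap k R)).obj
      (((Tor (ModuleCat.{0} R) n).obj M).obj M') ≅ (restrictTensor k M P.complex).homology n :=
  (restrictScalars.{0} (algebraMap k R)).mapIso
    (P.isoLeftDerivedObj ((tensoringLeft (ModuleCat.{0} R)).obj M) n) ≪≫
  ((((((tensoringLeft (ModuleCat.{0} R)).obj M).mapHomologicalComplex _).obj P.complex).sc
    n).mapHomologyIso (restrictScalars.{0} (algebraMap k R))).symm

end

variable {k A B : Type} [Field k] [CommRing A] [CommRing B] [Algebra k A] [Algebra k B]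

/-- The interchange of tensor products with external tensor products of complexes,
over the base field. -/
noncomputable def restrictTensorMapBifunctorIso (M : ModuleCat.{0} A) (N : ModuleCat.{0} B)
    (K : ChainComplex (ModuleCat.{0} A) ℕ) (L : ChainComplex (ModuleCat.{0} B) ℕ) :
    mapBifunctor (restrictTensor k M K) (restrictTensor k N L)
      (curriedTensor (ModuleCat.{0} k)) (ComplexShape.down ℕ) ≅
    restrictTensor k (((externalTensor k A B).obj M).obj N)
      (mapBifunctor K L (externalTensor k A B) (ComplexShape.down ℕ)) :=
  mapBifunctorComparison
    (K₁ := restrictTensor k M K) (L₁ := restrictTensor k N L) (H := curriedTensor (ModuleCat.{0} k))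
    (F := externalTensor k A B)
    (G := (tensoringLeft _).obj (((externalTensor k A B).obj M).obj N) ⋙
      restrictScalars.{0} (algebraMap k (A ⊗[k] B)))
    (fun i j => restrictExternalTensorIso (MonoidalCategory.tensorObj M (K.X i))
      (MonoidalCategory.tensorObj N (L.X j)) ≪≫
      (restrictScalars.{0} (algebraMap k (A ⊗[k] B))).mapIso
        (externalTensorInterchangeIso M (K.X i) N (L.X j)).symm)
    (fun i i' j => Functor.comp_trans_mapIso_symm_hom _ _ _ _ _
      (restrictExternalTensorIso_naturality_left (M ◁ K.d i i') _)
      (externalTensorInterchangeIso_naturality_left M (K.d i i') N (L.X j)))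
    (fun i j j' => Functor.comp_trans_mapIso_symm_hom _ _ _ _ _
      (restrictExternalTensorIso_naturality_right _ (N ◁ L.d j j'))
      (externalTensorInterchangeIso_naturality_right M (K.X i) N (L.d j j')))

lemma nonempty_restrict_tor_externalTensor_iso (M M' : ModuleCat.{0} A) (N N' : ModuleCat.{0} B)
    (n : ℕ) :
    Nonempty ((restrictScalars.{0} (algebraMap k (A ⊗[k] B))).obj
      (((Tor (ModuleCat.{0} (A ⊗[k] B)) n).obj (((externalTensor k A B).obj M).obj N)).obj
        (((externalTensor k A B).obj M').obj N')) ≅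
      ModuleCat.of k (⨁ p : {p : ℕ × ℕ // p.1 + p.2 = n},
        (restrictScalars.{0} (algebraMap k A)).obj (((Tor (ModuleCat.{0} A) p.1.1).obj M).obj M')
          ⊗[k] (restrictScalars.{0} (algebraMap k B)).obj
            (((Tor (ModuleCat.{0} B) p.1.2).obj N).obj N'))) := by
  let P := ProjectiveResolution.of M'
  let Q := ProjectiveResolution.of N'
  obtain ⟨e⟩ := ChainComplex.nonempty_homology_tensor_iso_directSum
    (restrictTensor k M P.complex) (restrictTensor k N Q.complex) n
  refine ⟨restrictTorIso k _ (externalTensorResolution k P Q) n ≪≫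
    (homologyMapIso (restrictTensorMapBifunctorIso M N P.complex Q.complex) n).symm ≪≫ e ≪≫
    (LinearEquiv.toModuleIso ?_)⟩
  exact DFinsupp.mapRange.linearEquiv fun p => TensorProduct.congr
    (restrictTorIso k M P p.1.1).toLinearEquiv.symm
    (restrictTorIso k N Q p.1.2).toLinearEquiv.symm

end ModuleCat

end

/-- Künneth formula for Tor over a tensor product of algebras: let `k` be a field, `A, B`
commutative `k`-algebras, `M, M'` modules over `A` and `N, N'` modules over `B`. Equip
`M ⊗[k] N` and `M' ⊗[k] N'` with their natural `A ⊗[k] B`-module structures (characterized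
by `(a ⊗ b) • (m ⊗ n) = (a • m) ⊗ (b • n)`). Then for every `n ≥ 0` there is an
isomorphism of `k`-vector spaces
`Tor_n^{A ⊗[k] B}(M ⊗[k] N, M' ⊗[k] N') ≅ ⊕_{i+j=n} Tor_i^A(M, M') ⊗[k] Tor_j^B(N, N')`. -/
theorem stmt_12 (k A B M M' N N' : Type) [Field k]
    [CommRing A] [CommRing B] [Algebra k A] [Algebra k B]
    [AddCommGroup M] [Module k M] [Module A M] [IsScalarTower k A M]
    [AddCommGroup M'] [Module k M'] [Module A M'] [IsScalarTower k A M']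
    [AddCommGroup N] [Module k N] [Module B N] [IsScalarTower k B N]
    [AddCommGroup N'] [Module k N'] [Module B N'] [IsScalarTower k B N']
    [Module (A ⊗[k] B) (M ⊗[k] N)]
    (hMN : ∀ (a : A) (b : B) (m : M) (x : N),
      (a ⊗ₜ[k] b) • (m ⊗ₜ[k] x) = (a • m) ⊗ₜ[k] (b • x))
    [Module (A ⊗[k] B) (M' ⊗[k] N')]
    (hMN' : ∀ (a : A) (b : B) (m : M') (x : N'),
      (a ⊗ₜ[k] b) • (m ⊗ₜ[k] x) = (a • m) ⊗ₜ[k] (b • x))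
    (n : ℕ) :
    Nonempty
      ((RestrictScalars k (A ⊗[k] B)
          (((Tor (ModuleCat (A ⊗[k] B)) n).obj
              (ModuleCat.of (A ⊗[k] B) (M ⊗[k] N))).obj
            (ModuleCat.of (A ⊗[k] B) (M' ⊗[k] N')))) ≃ₗ[k]
        ⨁ p : {p : ℕ × ℕ // p.1 + p.2 = n},
          (RestrictScalars k A
              (((Tor (ModuleCat A) p.1.1).obj (ModuleCat.of A M)).obj
                (ModuleCat.of A M'))) ⊗[k]
            (RestrictScalars k B
              (((Tor (ModuleCat B) p.1.2).obj (ModuleCat.of B N)).obj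
                (ModuleCat.of B N')))) := by
  obtain ⟨e⟩ := ModuleCat.nonempty_restrict_tor_externalTensor_iso (k := k)
    (ModuleCat.of A M) (ModuleCat.of A M') (ModuleCat.of B N) (ModuleCat.of B N') n
  let T := Tor (ModuleCat (A ⊗[k] B)) n
  let i := (T.mapIso (ModuleCat.externalTensorEquiv hMN).toModuleIso).app
    (ModuleCat.of (A ⊗[k] B) (M' ⊗[k] N')) ≪≫
      (T.obj _).mapIso (ModuleCat.externalTensorEquiv hMN').toModuleIso
  exact ⟨((ModuleCat.restrictScalars (algebraMap k (A ⊗[k] B))).mapIso i ≪≫ e).toLinearEquiv⟩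
end
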